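/- Let Ω ⊂ ℝ² be open, bounded and simply connected with real analytic boundary ∂Ω; let t and n denote the unit tangent and outward unit normal vector fields on ∂Ω. For h ∈ C¹(∂Ω) define (Hh)(v) := (1/π) lim_{ε→0} ∫_{∂Ω∖B_ε(v)} h(w) · [t(v)·(v−w)] / |v−w|² dw for v ∈ ∂Ω (arclength integral, B_ε(v) the Euclidean ball of radius ε about v). Let f,h ∈ C¹(∂Ω). If there exists an open connected set U ⊂ ℝ² with cl(Ω) ⊂ U and a vector field B ∈ C¹(U∖cl(Ω);ℝ²) ∩ C(U∖Ω;ℝ²) with div B = 0 and curl B = 0 on U∖cl(Ω), B·t = f and B·n = h on ∂Ω, then f − Hh is real analytic on ∂Ω. -/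

import Mathlib

open MeasureTheory Filter Topology Set

/-- Partial derivative in the first coordinate. -/
noncomputable def pdx (F : ℝ × ℝ → ℝ) (p : ℝ × ℝ) : ℝ :=
  deriv (fun x => F (x, p.2)) p.1

/-- Partial derivative in the second coordinate. -/
noncomputable def pdy (F : ℝ × ℝ → ℝ) (p : ℝ × ℝ) : ℝ :=
  deriv (fun y => F (p.1, y)) p.2

/-- Planar divergence of a vector field. -/
noncomputable def divg (B : ℝ × ℝ → ℝ × ℝ) (p : ℝ × ℝ) : ℝ :=
  pdx (fun q => (B q).1) p + pdy (fun q => (B q).2) p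

/-- Planar (scalar) curl of a vector field. -/
noncomputable def curl2 (B : ℝ × ℝ → ℝ × ℝ) (p : ℝ × ℝ) : ℝ :=
  pdx (fun q => (B q).2) p - pdy (fun q => (B q).1) p

/-- Euclidean dot product on `ℝ × ℝ`. -/
def dot (u v : ℝ × ℝ) : ℝ := u.1 * v.1 + u.2 * v.2

/-- Euclidean norm on `ℝ × ℝ`. -/
noncomputable def enorm2 (v : ℝ × ℝ) : ℝ := Real.sqrt (v.1 ^ 2 + v.2 ^ 2)

/-- A real analytic function `ℝ → ℂ` extends holomorphically to a complex neighbourhood. -/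
theorem AnalyticAt.exists_complex_extension {φ : ℝ → ℂ} {s₀ : ℝ} (hφ : AnalyticAt ℝ φ s₀) :
    ∃ G : ℂ → ℂ, AnalyticAt ℂ G s₀ ∧ ∀ᶠ s : ℝ in 𝓝 s₀, G s = φ s := by
  obtain ⟨p, hp⟩ := hφ
  set q : FormalMultilinearSeries ℂ ℂ ℂ := FormalMultilinearSeries.ofScalars ℂ p.coeff with hq
  have hrad : 0 < q.radius := by
    have h1 : p.radius ≤ q.radius := by
      refine ENNReal.le_of_forall_nnreal_lt fun r hr => ?_
      obtain ⟨C, -, hC⟩ := p.norm_mul_pow_le_of_lt_radius hr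
      refine q.le_radius_of_bound C fun n => ?_
      rw [hq, FormalMultilinearSeries.ofScalars_norm,
        ← FormalMultilinearSeries.norm_apply_eq_norm_coef]
      exact hC n
    exact hp.radius_pos.trans_le h1
  have hball := q.hasFPowerSeriesOnBall hrad
  have hsub : AnalyticAt ℂ (fun z : ℂ => z - s₀) s₀ := by fun_prop
  refine ⟨fun z => q.sum (z - s₀), ?_, ?_⟩
  · have h0 : AnalyticAt ℂ q.sum ((s₀ : ℂ) - s₀) := by
      rw [sub_self]; exact hball.analyticAt
    exact h0.fun_comp (f := fun z : ℂ => z - s₀) hsub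
  · filter_upwards [hasFPowerSeriesAt_iff'.1 hp] with s hs
    rw [← hs.tsum_eq]
    refine tsum_congr fun n => ?_
    rw [hq, FormalMultilinearSeries.ofScalars_apply_eq, Complex.real_smul, smul_eq_mul, mul_comm]
    push_cast
    rfl

/-- The real part of a holomorphic function is real analytic along the real axis. -/
theorem AnalyticAt.re_ofReal' {G : ℂ → ℂ} {s₀ : ℝ} (hG : AnalyticAt ℂ G s₀) :
    AnalyticAt ℝ (fun s : ℝ => (G s).re) s₀ := by
  have h1 : AnalyticAt ℝ G (Complex.ofRealCLM s₀) := hG.restrictScalars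
  have h2 := h1.comp (Complex.ofRealCLM.analyticAt s₀)
  exact (Complex.reCLM.analyticAt _).comp h2

/-- The imaginary part of a holomorphic function is real analytic along the real axis. -/
theorem AnalyticAt.im_ofReal' {G : ℂ → ℂ} {s₀ : ℝ} (hG : AnalyticAt ℂ G s₀) :
    AnalyticAt ℝ (fun s : ℝ => (G s).im) s₀ := by
  have h1 : AnalyticAt ℝ G (Complex.ofRealCLM s₀) := hG.restrictScalars
  have h2 := h1.comp (Complex.ofRealCLM.analyticAt s₀)
  exact (Complex.imCLM.analyticAt _).comp h2

/-- A bounded family of holomorphic functions integrates to a holomorphic function. -/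
theorem differentiableOn_integral_of_bounded {α : Type*} [MeasurableSpace α] {μ : Measure α}
    [IsFiniteMeasure μ] {D : Set ℂ} (hD : IsOpen D) {K : ℂ → α → ℂ} {C : ℝ}
    (hK : ∀ᵐ a ∂μ, DifferentiableOn ℂ (fun z => K z a) D)
    (hm : ∀ z ∈ D, AEStronglyMeasurable (K z) μ)
    (hb : ∀ᵐ a ∂μ, ∀ z ∈ D, ‖K z a‖ ≤ C) :
    DifferentiableOn ℂ (fun z => ∫ a, K z a ∂μ) D := by
  intro z hz
  obtain ⟨r, hr, hrD⟩ := Metric.isOpen_iff.1 hD z hz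
  have hr2 : 0 < r / 2 := by positivity
  have hsub : ∀ w ∈ Metric.ball z (r / 2), Metric.closedBall w (r / 2) ⊆ D := by
    intro w hw x hx
    apply hrD
    rw [Metric.mem_ball] at hw ⊢
    rw [Metric.mem_closedBall] at hx
    linarith [dist_triangle x w z]
  have hderiv : ∀ᵐ a ∂μ, HasDerivAt (fun w => K w a) (deriv (fun w => K w a) z) z := by
    filter_upwards [hK] with a ha
    exact (ha.differentiableAt (hD.mem_nhds hz)).hasDerivAt
  have key := hasDerivAt_integral_of_dominated_loc_of_deriv_le (μ := μ) (F := K) (x₀ := z)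
    (F' := fun w a => deriv (fun w => K w a) w) (bound := fun _ => C / (r / 2))
    (Metric.ball_mem_nhds z hr2) ?_ ?_ ?_ ?_ (integrable_const _) ?_
  · exact key.2.differentiableAt.differentiableWithinAt
  · filter_upwards [hD.mem_nhds hz] with w hw using hm w hw
  · refine Integrable.of_bound (hm z hz) C ?_
    filter_upwards [hb] with a ha using ha z hz
  · -- the derivative is a limit of difference quotients
    have hseq : Tendsto (fun n : ℕ => z + (r / 2 / ((n : ℝ) + 1) : ℝ)) atTop (𝓝[≠] z) := by
      refine tendsto_nhdsWithin_iff.2 ⟨?_, Eventually.of_forall fun n => ?_⟩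
      · have h1 : Tendsto (fun n : ℕ => r / 2 / ((n : ℝ) + 1)) atTop (𝓝 0) :=
          tendsto_const_div_atTop_nhds_zero_nat (r / 2) |>.comp (tendsto_add_atTop_nat 1) |>.congr
            fun n => by simp
        have h2 := (Complex.continuous_ofReal.tendsto 0).comp h1
        simpa using h2.const_add z
      · have : (r / 2 / ((n : ℝ) + 1) : ℝ) ≠ 0 := by positivity
        simpa only [mem_compl_iff, mem_singleton_iff, add_eq_left, Complex.ofReal_eq_zero] using this
    have hev : ∀ n : ℕ, z + (r / 2 / ((n : ℝ) + 1) : ℝ) ∈ D := by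
      intro n
      apply hsub z (Metric.mem_ball_self hr2)
      rw [Metric.mem_closedBall, dist_eq_norm, add_sub_cancel_left, Complex.norm_real,
        Real.norm_of_nonneg (by positivity)]
      apply div_le_self hr2.le
      have : (0:ℝ) ≤ n := by positivity
      linarith
    refine aestronglyMeasurable_of_tendsto_ae atTop
      (f := fun (n : ℕ) a => slope (fun w => K w a) z (z + (r / 2 / ((n : ℝ) + 1) : ℝ))) ?_ ?_
    · intro n
      simp only [slope_def_field]
      exact (((hm _ (hev n)).sub (hm z hz)).mul_const
        (z + (r / 2 / ((n : ℝ) + 1) : ℝ) - z)⁻¹).congr (ae_of_all _ fun a => by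
          simp [div_eq_mul_inv])
    · filter_upwards [hderiv] with a ha
      exact (hasDerivAt_iff_tendsto_slope.1 ha).comp hseq
  · filter_upwards [hK, hb] with a ha hba w hw
    refine Complex.norm_deriv_le_of_forall_mem_sphere_norm_le hr2 ?_ ?_
    · refine (ha.mono ?_).diffContOnCl
      rw [closure_ball _ hr2.ne']
      exact hsub w hw
    · intro x hx
      exact hba x (hsub w hw (Metric.sphere_subset_closedBall hx))
  · filter_upwards [hK] with a ha w hw
    exact (ha.differentiableAt (hD.mem_nhds (hsub w hw (Metric.mem_closedBall_self hr2.le)))).hasDerivAt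

/-- The Cauchy transform of a density along a curve is analytic off the curve. -/
theorem analyticAt_integral_div_sub {α β : ℝ} {φ p : ℝ → ℂ} (hφ : ContinuousOn φ (uIcc α β))
    (hp : ContinuousOn p (uIcc α β)) {w₀ : ℂ} (hw : ∀ y ∈ uIcc α β, p y ≠ w₀) :
    AnalyticAt ℂ (fun w => ∫ y in α..β, φ y / (p y - w)) w₀ := by
  obtain ⟨δ, hδ, hdist⟩ : ∃ δ > 0, ∀ y ∈ uIcc α β, 2 * δ ≤ ‖p y - w₀‖ := by
    obtain ⟨y₀, hy₀, hmin⟩ := isCompact_uIcc.exists_isMinOn nonempty_uIcc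
      (hp.sub continuousOn_const).norm (f := fun y => ‖p y - w₀‖)
    have : 0 < ‖p y₀ - w₀‖ := norm_pos_iff.2 (sub_ne_zero.2 (hw y₀ hy₀))
    refine ⟨‖p y₀ - w₀‖ / 2, by positivity, fun y hy => ?_⟩
    have := hmin hy
    simp only [mem_ofPred_eq] at this
    linarith
  obtain ⟨M, hM⟩ := isCompact_uIcc.exists_bound_of_continuousOn hφ
  have hfar : ∀ y ∈ uIcc α β, ∀ w ∈ Metric.ball w₀ δ, δ ≤ ‖p y - w‖ := by
    intro y hy w hw
    have h1 := hdist y hy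
    have h2 : ‖p y - w₀‖ ≤ ‖p y - w‖ + ‖w - w₀‖ := norm_sub_le_norm_sub_add_norm_sub _ _ _
    rw [Metric.mem_ball, dist_eq_norm] at hw
    linarith
  have hne : ∀ y ∈ uIcc α β, ∀ w ∈ Metric.ball w₀ δ, p y - w ≠ 0 := fun y hy w hw =>
    norm_pos_iff.1 (hδ.trans_le (hfar y hy w hw))
  have hae : ∀ᵐ y ∂(volume.restrict (uIoc α β)), y ∈ uIcc α β := by
    filter_upwards [ae_restrict_mem measurableSet_uIoc] with y hy using uIoc_subset_uIcc hy
  have : IsFiniteMeasure (volume.restrict (uIoc α β)) := by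
    rw [uIoc]; infer_instance
  have key : DifferentiableOn ℂ (fun w => ∫ y in uIoc α β, φ y / (p y - w))
      (Metric.ball w₀ δ) := by
    refine differentiableOn_integral_of_bounded Metric.isOpen_ball (C := M / δ) ?_ ?_ ?_
    · filter_upwards [hae] with y hy
      exact (differentiableOn_const _).div ((differentiableOn_const _).sub differentiableOn_id)
        (hne y hy)
    · intro w hw
      refine ContinuousOn.aestronglyMeasurable ?_ measurableSet_uIoc
      exact (hφ.div (hp.sub continuousOn_const) fun y hy => hne y hy w hw).mono uIoc_subset_uIcc
    · filter_upwards [hae] with y hy w hw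
      rw [norm_div]
      exact div_le_div₀ ((norm_nonneg _).trans (hM y hy)) (hM y hy) hδ (hfar y hy w hw)
  have h2 := key.analyticAt (Metric.ball_mem_nhds w₀ hδ)
  simp only [intervalIntegral.intervalIntegral_eq_integral_uIoc]
  exact analyticAt_const.smul h2

/-- A Plemelj formula: boundary value from below of the Cauchy integral of a continuous density on
an interval which is differentiable at the point in question. -/
theorem tendsto_integral_div_sub_add_mul_I {a b s : ℝ} (hs : s ∈ Ioo a b) {φ : ℝ → ℂ}
    (hφ : ContinuousOn φ (Icc a b)) (hφs : DifferentiableAt ℝ φ s) :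
    Tendsto (fun η : ℝ => ∫ x in a..b, φ x / (x - (s - η * Complex.I))) (𝓝[>] 0)
      (𝓝 ((∫ x in a..b, dslope φ s x) +
        φ s * (Real.log (b - s) - Real.log (s - a) - Real.pi * Complex.I))) := by
  have hab : a ≤ b := (hs.1.trans hs.2).le
  have hds : ContinuousOn (dslope φ s) (uIcc a b) := by
    rw [uIcc_of_le hab]
    exact (continuousOn_dslope (Icc_mem_nhds hs.1 hs.2)).2 ⟨hφ, hφs⟩
  have hne : ∀ η : ℝ, 0 < η → ∀ x : ℝ, (x : ℂ) - (s - η * Complex.I) ≠ 0 := by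
    intro η hη x h
    have := congrArg Complex.im h
    simp at this
    exact hη.ne' this
  have h1 : Tendsto (fun η : ℝ => ∫ x in a..b,
      dslope φ s x * ((x - s : ℂ) / (x - (s - η * Complex.I)))) (𝓝[>] 0)
      (𝓝 (∫ x in a..b, dslope φ s x)) := by
    refine intervalIntegral.tendsto_integral_filter_of_dominated_convergence
      (fun x => ‖dslope φ s x‖) ?_ ?_ hds.norm.intervalIntegrable ?_
    · filter_upwards [self_mem_nhdsWithin] with η hη
      refine ContinuousOn.aestronglyMeasurable ?_ measurableSet_uIoc
      refine (hds.mono uIoc_subset_uIcc).mul ?_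
      refine ContinuousOn.div (by fun_prop) (by fun_prop) fun x _ => hne η hη x
    · filter_upwards [self_mem_nhdsWithin] with η hη
      refine ae_of_all _ fun x _ => ?_
      rw [norm_mul]
      refine mul_le_of_le_one_right (norm_nonneg _) ?_
      rw [norm_div]
      refine div_le_one_of_le₀ ?_ (norm_nonneg _)
      have : ((x : ℂ) - s) = ((((x : ℂ) - (s - η * Complex.I)).re : ℝ) : ℂ) := by simp
      rw [this, Complex.norm_real]
      exact Complex.abs_re_le_norm _
    · have : ∀ᵐ x : ℝ, x ≠ s := by simp [ae_iff]
      filter_upwards [this] with x hx _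
      have hx' : (x : ℂ) - s ≠ 0 := by
        rw [← Complex.ofReal_sub, Complex.ofReal_ne_zero]; exact sub_ne_zero.2 hx
      have hc : ContinuousAt (fun η : ℝ => (x - s : ℂ) / (x - (s - η * Complex.I))) 0 := by
        refine ContinuousAt.div (by fun_prop) (by fun_prop) ?_
        simpa using hx'
      have := (hc.tendsto.mono_left nhdsWithin_le_nhds).const_mul (dslope φ s x)
        (x := 𝓝[>] (0:ℝ))
      simpa [div_self hx'] using this
  have h2 : ∀ η : ℝ, 0 < η → ∫ x in a..b, (1 : ℂ) / (x - (s - η * Complex.I)) =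
      Complex.log (b - (s - η * Complex.I)) - Complex.log (a - (s - η * Complex.I)) := by
    intro η hη
    refine intervalIntegral.integral_eq_sub_of_hasDerivAt
      (f := fun x : ℝ => Complex.log (x - (s - η * Complex.I))) (fun x _ => ?_) ?_
    · have hd : HasDerivAt (fun x : ℝ => (x : ℂ) - (s - η * Complex.I)) 1 x :=
        (Complex.ofRealCLM.hasDerivAt (x := x)).sub_const _
      refine hd.clog_real ?_
      right
      simp [hη.ne']
    · refine ContinuousOn.intervalIntegrable ?_
      exact ContinuousOn.div (by fun_prop) (by fun_prop) fun x _ => hne η hη x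
  have h3 : Tendsto (fun η : ℝ => Complex.log (b - (s - η * Complex.I))) (𝓝[>] 0)
      (𝓝 (Real.log (b - s))) := by
    have hc : ContinuousAt (fun η : ℝ => Complex.log (b - (s - η * Complex.I))) 0 := by
      refine ContinuousAt.clog (by fun_prop) ?_
      left
      simpa using hs.2
    have := hc.tendsto.mono_left (nhdsWithin_le_nhds (s := Ioi 0))
    rw [Complex.ofReal_log (sub_pos.2 hs.2).le]
    simpa using this
  have h4 : Tendsto (fun η : ℝ => Complex.log (a - (s - η * Complex.I))) (𝓝[>] 0)
      (𝓝 (Real.log (s - a) + Real.pi * Complex.I)) := by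
    have h5 := Complex.tendsto_log_nhdsWithin_im_nonneg_of_re_neg_of_im_zero
      (z := ((a - s : ℝ) : ℂ)) (by simpa using hs.1) (by simp)
    have h6 : Tendsto (fun η : ℝ => (a : ℂ) - (s - η * Complex.I)) (𝓝[>] 0)
        (𝓝[{z : ℂ | 0 ≤ z.im}] ((a - s : ℝ) : ℂ)) := by
      refine tendsto_nhdsWithin_iff.2 ⟨?_, ?_⟩
      · have hc : ContinuousAt (fun η : ℝ => (a : ℂ) - (s - η * Complex.I)) 0 := by fun_prop
        have := hc.tendsto.mono_left (nhdsWithin_le_nhds (s := Ioi 0))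
        simpa using this
      · filter_upwards [self_mem_nhdsWithin] with η hη
        simpa using (le_of_lt hη : (0:ℝ) ≤ η)
    have h7 := h5.comp h6
    rw [Complex.norm_real, Real.norm_eq_abs, abs_sub_comm, abs_of_pos (sub_pos.2 hs.1)] at h7
    exact h7
  have h5 := h1.add ((h3.sub h4).const_mul (φ s))
  rw [← sub_sub] at h5
  refine h5.congr' ?_
  filter_upwards [self_mem_nhdsWithin] with η hη
  rw [← h2 η hη, ← intervalIntegral.integral_const_mul, ← intervalIntegral.integral_add]
  · refine intervalIntegral.integral_congr fun x _ => ?_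
    have h8 : dslope φ s x * (x - s : ℂ) = φ x - φ s := by
      rw [← sub_smul_dslope φ s x, Complex.real_smul]; push_cast; ring
    rw [← mul_div_assoc, h8]
    ring
  · refine ContinuousOn.intervalIntegrable ?_
    refine hds.mul ?_
    exact ContinuousOn.div (by fun_prop) (by fun_prop) fun x _ => hne η hη x
  · refine ContinuousOn.intervalIntegrable ?_
    refine continuousOn_const.mul ?_
    exact ContinuousOn.div (by fun_prop) (by fun_prop) fun x _ => hne η hη x

/-- If `u - i g` is the boundary value on `[a, b]` of a function holomorphic in a rectangle above
this interval, then `π u` differs from the finite Hilbert transform of `g` by a real analytic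
function. -/
theorem exists_analyticAt_boundary_value {a b c : ℝ} (hab : a < b) (hc : 0 < c) {Φ : ℂ → ℂ}
    (hcont : ContinuousOn Φ (Icc a b ×ℂ Icc 0 c))
    (hdiff : DifferentiableOn ℂ Φ (Ioo a b ×ℂ Ioo 0 c)) {u g : ℝ → ℝ}
    (hu : Differentiable ℝ u) (hg : Differentiable ℝ g)
    (hΦ : ∀ x ∈ Icc a b, Φ x = u x - g x * Complex.I) :
    ∃ A : ℂ → ℂ, ∀ s ∈ Ioo a b, AnalyticAt ℂ A s ∧
      Real.pi * u s = -(∫ x in a..b, dslope g s x) +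
        g s * (Real.log (s - a) - Real.log (b - s)) + (A s).im := by
  have hre : uIcc a b = Icc a b := uIcc_of_le hab.le
  have him : uIcc 0 c = Icc 0 c := uIcc_of_le hc.le
  have htop : ContinuousOn (fun x : ℝ => Φ (x + c * Complex.I)) (uIcc a b) := by
    refine hcont.comp (by fun_prop) fun x hx => ?_
    rw [hre] at hx
    simpa [Complex.mem_reProdIm, hc.le] using hx
  have hside : ∀ d ∈ Icc a b, ContinuousOn (fun y : ℝ => Φ (d + y * Complex.I)) (uIcc 0 c) := by
    intro d hd
    refine hcont.comp (by fun_prop) fun y hy => ?_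
    rw [him] at hy
    simpa [Complex.mem_reProdIm, hy.1, hy.2] using hd
  set A : ℂ → ℂ := fun w =>
    -(∫ x in a..b, Φ (x + c * Complex.I) / (x + c * Complex.I - w)) +
      Complex.I * (∫ y in (0:ℝ)..c, Φ (b + y * Complex.I) / (b + y * Complex.I - w)) -
      Complex.I * (∫ y in (0:ℝ)..c, Φ (a + y * Complex.I) / (a + y * Complex.I - w)) with hA
  refine ⟨A, fun s hs => ?_⟩
  have hAan : AnalyticAt ℂ A s := by
    refine ((analyticAt_integral_div_sub htop (by fun_prop) ?_).neg.add
      (analyticAt_const.mul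
        (analyticAt_integral_div_sub (hside b ⟨hab.le, le_rfl⟩) (by fun_prop) ?_))).sub
      (analyticAt_const.mul
        (analyticAt_integral_div_sub (hside a ⟨le_rfl, hab.le⟩) (by fun_prop) ?_))
    · intro y _ h
      have := congrArg Complex.im h
      simp at this
      exact hc.ne' this
    · intro y _ h
      have := congrArg Complex.re h
      simp at this
      exact hs.2.ne' this
    · intro y _ h
      have := congrArg Complex.re h
      simp at this
      exact hs.1.ne this
  refine ⟨hAan, ?_⟩
  set φ : ℝ → ℂ := fun x => u x - g x * Complex.I with hφdef
  have hφ : ∀ x, HasDerivAt φ (deriv u x - deriv g x * Complex.I) x := fun x =>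
    (hu x).hasDerivAt.ofReal_comp.sub ((hg x).hasDerivAt.ofReal_comp.mul_const _)
  have hlim := tendsto_integral_div_sub_add_mul_I hs
    (fun x _ => (hφ x).continuousAt.continuousWithinAt) (hφ s).differentiableAt
  have hlim2 : Tendsto (fun η : ℝ => -A (s - η * Complex.I)) (𝓝[>] 0) (𝓝 (-A s)) := by
    have hc0 : ContinuousAt (fun η : ℝ => (s - η * Complex.I : ℂ)) 0 := by fun_prop
    have h0 : (s - (0:ℝ) * Complex.I : ℂ) = s := by simp
    have hc1 : ContinuousAt A (s - (0:ℝ) * Complex.I : ℂ) := by rw [h0]; exact hAan.continuousAt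
    have := (hc1.comp (f := fun η : ℝ => (s - η * Complex.I : ℂ)) hc0).tendsto.mono_left
      (nhdsWithin_le_nhds (s := Ioi 0))
    simp only [Function.comp_def, h0] at this
    exact this.neg
  have heq : (fun η : ℝ => ∫ x in a..b, φ x / (x - (s - η * Complex.I))) =ᶠ[𝓝[>] 0]
      fun η : ℝ => -A (s - η * Complex.I) := by
    filter_upwards [self_mem_nhdsWithin] with η (hη : 0 < η)
    have hne : ∀ z ∈ {z : ℂ | 0 ≤ z.im}, z - (s - η * Complex.I) ≠ 0 := by
      intro z hz h
      have := congrArg Complex.im h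
      simp at this
      have hz' : 0 ≤ z.im := hz
      linarith
    have hrect := Complex.integral_boundary_rect_eq_zero_of_continuousOn_of_differentiableOn
      (fun z => Φ z / (z - (s - η * Complex.I))) a (b + c * Complex.I) ?_ ?_
    · simp only [Complex.ofReal_im, Complex.ofReal_re, Complex.add_re, Complex.mul_re,
        Complex.I_re, Complex.I_im, Complex.add_im, Complex.mul_im, mul_zero, mul_one, zero_mul,
        sub_zero, add_zero, zero_add, Complex.ofReal_zero, smul_eq_mul] at hrect
      have hb : ∫ x in a..b, φ x / (x - (s - η * Complex.I)) =
          ∫ x in a..b, Φ x / (x - (s - η * Complex.I)) := by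
        refine intervalIntegral.integral_congr fun x hx => ?_
        rw [hre] at hx
        simp only [hΦ x hx, hφdef]
      rw [hb, hA]
      linear_combination hrect
    · simp only [Complex.ofReal_im, Complex.ofReal_re, Complex.add_re, Complex.mul_re,
        Complex.I_re, Complex.I_im, Complex.add_im, Complex.mul_im, mul_zero, mul_one,
        sub_zero, add_zero, zero_add]
      rw [hre, him]
      refine hcont.div (by fun_prop) fun z hz => hne z ?_
      exact (Complex.mem_reProdIm.1 hz).2.1
    · simp only [Complex.ofReal_im, Complex.ofReal_re, Complex.add_re, Complex.mul_re,
        Complex.I_re, Complex.I_im, Complex.add_im, Complex.mul_im, mul_zero, mul_one,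
        sub_zero, add_zero, zero_add, min_eq_left hab.le, max_eq_right hab.le,
        min_eq_left hc.le, max_eq_right hc.le]
      refine hdiff.div (by fun_prop) fun z hz => hne z ?_
      exact (Complex.mem_reProdIm.1 hz).2.1.le
  have hmain := tendsto_nhds_unique (hlim.congr' heq) hlim2
  have hds : ∫ x in a..b, dslope φ s x =
      (∫ x in a..b, dslope u s x : ℝ) - (∫ x in a..b, dslope g s x : ℝ) * Complex.I := by
    have hcu : Continuous (dslope u s) := by
      rw [← continuousOn_univ, continuousOn_dslope univ_mem]
      exact ⟨hu.continuous.continuousOn, hu s⟩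
    have hcg : Continuous (dslope g s) := by
      rw [← continuousOn_univ, continuousOn_dslope univ_mem]
      exact ⟨hg.continuous.continuousOn, hg s⟩
    rw [← intervalIntegral.integral_ofReal, ← intervalIntegral.integral_ofReal,
      ← intervalIntegral.integral_mul_const, ← intervalIntegral.integral_sub]
    · refine intervalIntegral.integral_congr fun x _ => ?_
      rcases eq_or_ne x s with rfl | hx
      · simp only [dslope_same]
        exact (hφ x).deriv
      · simp only [dslope_of_ne _ hx, slope_def_module, hφdef, Complex.real_smul, smul_eq_mul]
        push_cast
        ring
    · exact (Complex.continuous_ofReal.comp hcu).intervalIntegrable _ _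
    · exact ((Complex.continuous_ofReal.comp hcg).mul continuous_const).intervalIntegrable _ _
  rw [hds] at hmain
  have him2 := congrArg Complex.im hmain
  simp [hφdef] at him2
  linarith

/-- Truncating an integrable function near the zero set of `ρ` does not change the integral in the
limit. -/
theorem tendsto_integral_truncation {α β : ℝ} {F ρ : ℝ → ℝ}
    (hF : IntervalIntegrable F volume α β) (hρ : Measurable ρ)
    (hpos : ∀ᵐ x : ℝ, x ∈ uIoc α β → 0 < ρ x) :
    Tendsto (fun ε : ℝ => ∫ x in α..β, if ε ≤ ρ x then F x else 0) (𝓝[>] 0)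
      (𝓝 (∫ x in α..β, F x)) := by
  refine intervalIntegral.tendsto_integral_filter_of_dominated_convergence (fun x => ‖F x‖)
    (Eventually.of_forall fun ε => ?_) (Eventually.of_forall fun ε => ?_) hF.norm ?_
  · have := hF.def'.aestronglyMeasurable.indicator
      (measurableSet_le (measurable_const (a := ε)) hρ)
    refine this.congr (ae_of_all _ fun x => ?_)
    simp [indicator]
  · refine ae_of_all _ fun x _ => ?_
    split_ifs <;> simp
  · filter_upwards [hpos] with x hx hxm
    refine tendsto_const_nhds.congr' ?_
    filter_upwards [nhdsWithin_le_nhds (Iio_mem_nhds (hx hxm))] with ε hε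
    rw [if_pos (le_of_lt hε)]

theorem intervalIntegrable_truncation {a b s ε : ℝ} {ρ : ℝ → ℝ} {M : ℝ} (hε : 0 < ε)
    (hρ : Measurable ρ) (hM : ∀ x ∈ uIcc a b, ρ x ≤ M * |x - s|) :
    IntervalIntegrable (fun x => if ε ≤ ρ x then 1 / (s - x) else 0) volume a b := by
  rw [intervalIntegrable_iff]
  have : IsFiniteMeasure (volume.restrict (uIoc a b)) := by
    rw [uIoc]; infer_instance
  refine Integrable.of_bound (C := |M| / ε) ?_ ?_
  · refine (Measurable.ite (measurableSet_le measurable_const hρ) ?_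
      measurable_const).aestronglyMeasurable
    fun_prop
  · filter_upwards [ae_restrict_mem measurableSet_uIoc] with x hx
    split_ifs with h
    · have h1 := h.trans (hM x (uIoc_subset_uIcc hx))
      have h2 : 0 < M * |x - s| := hε.trans_le h1
      have h3 : 0 < |x - s| := by
        rcases (abs_nonneg (x - s)).eq_or_lt with h | h
        · rw [← h] at h2; simp at h2
        · exact h
      rw [Real.norm_eq_abs, abs_div, abs_one, abs_sub_comm, div_le_div_iff₀ h3 hε, one_mul]
      exact h1.trans (mul_le_mul_of_nonneg_right (le_abs_self M) h3.le)
    · simp only [norm_zero]; positivity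

theorem integral_symmetric_truncation {a b s c ε : ℝ} (hc : 0 < c) (hε : 0 < ε)
    (ha : ε < c * (s - a)) (hb : ε < c * (b - s)) :
    ∫ x in a..b, (if ε ≤ c * |x - s| then 1 / (s - x) else 0) =
      Real.log (s - a) - Real.log (b - s) := by
  set r := ε / c with hr
  have hr0 : 0 < r := by positivity
  have har : r < s - a := by rw [hr, div_lt_iff₀ hc]; linarith
  have hbr : r < b - s := by rw [hr, div_lt_iff₀ hc]; linarith
  have hiff : ∀ x, ε ≤ c * |x - s| ↔ r ≤ |x - s| := fun x => by
    rw [hr, div_le_iff₀ hc, mul_comm]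
  simp only [hiff]
  have hInt : ∀ p q : ℝ, IntervalIntegrable (fun x => if r ≤ |x - s| then 1 / (s - x) else 0)
      volume p q := fun p q =>
    intervalIntegrable_truncation hr0 (by fun_prop) (M := 1) fun x _ => by simp
  rw [← intervalIntegral.integral_add_adjacent_intervals (hInt a (s - r)) (hInt (s - r) b),
    ← intervalIntegral.integral_add_adjacent_intervals (hInt (s - r) (s + r)) (hInt (s + r) b)]
  have h1 : ∫ x in a..(s - r), (if r ≤ |x - s| then 1 / (s - x) else 0) =
      Real.log (s - a) - Real.log r := by
    have : ∫ x in a..(s - r), (if r ≤ |x - s| then 1 / (s - x) else 0) =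
        ∫ x in a..(s - r), (s - x)⁻¹ := by
      refine intervalIntegral.integral_congr fun x hx => ?_
      rw [uIcc_of_le (by linarith)] at hx
      rw [if_pos, one_div]
      rw [abs_of_nonpos] <;> linarith [hx.2]
    rw [this, intervalIntegral.integral_comp_sub_left (fun x => x⁻¹) s, integral_inv_of_pos
      (by linarith) (by linarith), Real.log_div (by linarith) (by linarith), sub_sub_cancel]
  have h2 : ∫ x in (s - r)..(s + r), (if r ≤ |x - s| then 1 / (s - x) else 0) = 0 := by
    have hae : ∀ᵐ x : ℝ, x ≠ s + r := by simp [ae_iff]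
    refine intervalIntegral.integral_zero_ae ?_
    filter_upwards [hae] with x hx hxm
    rw [uIoc_of_le (by linarith)] at hxm
    rw [if_neg]
    rw [not_le, abs_lt]
    have := lt_of_le_of_ne hxm.2 hx
    constructor <;> linarith [hxm.1]
  have h3 : ∫ x in (s + r)..b, (if r ≤ |x - s| then 1 / (s - x) else 0) =
      Real.log r - Real.log (b - s) := by
    have : ∫ x in (s + r)..b, (if r ≤ |x - s| then 1 / (s - x) else 0) =
        ∫ x in (s + r)..b, -(x - s)⁻¹ := by
      refine intervalIntegral.integral_congr fun x hx => ?_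
      rw [uIcc_of_le (by linarith)] at hx
      rw [if_pos, one_div, ← inv_neg, neg_sub]
      rw [abs_of_nonneg] <;> linarith [hx.1]
    rw [this, intervalIntegral.integral_neg, intervalIntegral.integral_comp_sub_right
      (fun x => x⁻¹) s, integral_inv_of_pos (by linarith) (by linarith),
      Real.log_div (by linarith) (by linarith), add_sub_cancel_left]
    ring
  rw [h1, h2, h3]
  ring

/-- The principal value of `∫ dx / (s - x)` does not depend on the precise shape of the
truncation, as long as the latter is symmetric to first order. -/
theorem tendsto_integral_truncation_inv {a b s c m M : ℝ} (hs : s ∈ Ioo a b) (hc : 0 < c)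
    (hm : 0 < m) {ρ : ℝ → ℝ} (hρ : Measurable ρ) (hlow : ∀ x ∈ Icc a b, m * |x - s| ≤ ρ x)
    (hM : ∀ x ∈ Icc a b, ρ x ≤ M * |x - s|)
    (ho : (fun x => ρ x - c * |x - s|) =o[𝓝 s] fun x => x - s) :
    Tendsto (fun ε : ℝ => ∫ x in a..b, if ε ≤ ρ x then 1 / (s - x) else 0) (𝓝[>] 0)
      (𝓝 (Real.log (s - a) - Real.log (b - s))) := by
  have hab : a ≤ b := (hs.1.trans hs.2).le
  rw [Metric.tendsto_nhds]
  intro e he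
  set m' := min m c with hm'
  have hm'0 : 0 < m' := lt_min hm hc
  obtain ⟨θ, hθ, hθm, hθe⟩ : ∃ θ > 0, θ ≤ m' / 2 ∧ 8 * θ / m' < e := by
    refine ⟨min (m' / 2) (e * m' / 16), by positivity, min_le_left _ _, ?_⟩
    rw [div_lt_iff₀ hm'0]
    have := min_le_right (m' / 2) (e * m' / 16)
    nlinarith [mul_pos he hm'0]
  obtain ⟨δ, hδ, hball⟩ := Metric.eventually_nhds_iff.1 (ho.bound hθ)
  have hsa := sub_pos.2 hs.1
  have hsb := sub_pos.2 hs.2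
  have hev1 : ∀ᶠ ε in 𝓝[>] (0:ℝ), ε < c * (s - a) :=
    nhdsWithin_le_nhds (Iio_mem_nhds (by positivity))
  have hev2 : ∀ᶠ ε in 𝓝[>] (0:ℝ), ε < c * (b - s) :=
    nhdsWithin_le_nhds (Iio_mem_nhds (by positivity))
  have hev3 : ∀ᶠ ε in 𝓝[>] (0:ℝ), ε < m' * δ :=
    nhdsWithin_le_nhds (Iio_mem_nhds (by positivity))
  filter_upwards [hev1, hev2, hev3, self_mem_nhdsWithin] with ε h1 h2 h3 (hε : 0 < ε)
  rw [← integral_symmetric_truncation hc hε h1 h2, dist_eq_norm,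
    ← intervalIntegral.integral_sub
      (intervalIntegrable_truncation hε hρ (by rwa [uIcc_of_le hab]))
      (intervalIntegrable_truncation hε (by fun_prop) (M := c) fun x _ => le_rfl)]
  set l := ε * (1 - θ / m') / c with hl
  set L := ε * (1 + θ / m') / c with hL
  have hθ2 : θ / m' ≤ 1 / 2 := by rw [div_le_iff₀ hm'0]; linarith
  have hl0 : ε / (2 * c) ≤ l := by
    rw [hl, div_le_div_iff₀ (by positivity) hc]
    nlinarith [mul_pos hε hc]
  have hlpos : 0 < l := lt_of_lt_of_le (by positivity) hl0
  have hlL : l ≤ L := by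
    rw [hl, hL]
    gcongr
    have : 0 ≤ θ / m' := by positivity
    linarith
  set S : Set ℝ := Icc (s - L) (s - l) ∪ Icc (s + l) (s + L) with hS
  have hSmeas : MeasurableSet S := measurableSet_Icc.union measurableSet_Icc
  have hvol : volume.real S ≤ 2 * (L - l) := by
    refine (measureReal_union_le _ _).trans ?_
    rw [Real.volume_real_Icc_of_le (by linarith), Real.volume_real_Icc_of_le (by linarith)]
    linarith
  have hSfin : volume S ≠ ⊤ := by
    refine ((measure_union_le _ _).trans_lt ?_).ne
    simp [ENNReal.add_lt_top]
  have hbound : ∀ x ∈ Icc a b, ‖(if ε ≤ ρ x then 1 / (s - x) else 0) -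
      (if ε ≤ c * |x - s| then 1 / (s - x) else 0)‖ ≤ S.indicator (fun _ => 2 * c / ε) x := by
    intro x hx
    have hind : 0 ≤ S.indicator (fun _ => 2 * c / ε) x :=
      indicator_nonneg (fun _ _ => by positivity) x
    have hlo := hlow x hx
    -- the key estimate
    have key : |x - s| ≤ ε / m' → |c * |x - s| - ε| ≤ abs (ρ x - c * |x - s|) →
        ‖1 / (s - x)‖ ≤ S.indicator (fun _ => 2 * c / ε) x := by
      intro hk1 hk2
      have hd : dist x s < δ := by
        rw [Real.dist_eq]
        refine hk1.trans_lt ?_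
        rw [div_lt_iff₀ hm'0]; linarith
      have hk3 := hball hd
      rw [Real.norm_eq_abs, Real.norm_eq_abs] at hk3
      have hk4 : |c * |x - s| - ε| ≤ ε * (θ / m') := by
        refine (hk2.trans hk3).trans ?_
        calc θ * |x - s| ≤ θ * (ε / m') := by gcongr
          _ = ε * (θ / m') := by ring
      obtain ⟨hk5, hk6⟩ := abs_le.1 hk4
      have hk7 : l ≤ |x - s| := by
        rw [hl, div_le_iff₀ hc]; linarith
      have hk8 : |x - s| ≤ L := by
        rw [hL, le_div_iff₀ hc]; linarith
      have hxS : x ∈ S := by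
        rcases le_total s x with h | h
        · right
          rw [abs_of_nonneg (by linarith)] at hk7 hk8
          constructor <;> linarith
        · left
          rw [abs_of_nonpos (by linarith)] at hk7 hk8
          constructor <;> linarith
      rw [indicator_of_mem hxS, Real.norm_eq_abs, abs_div, abs_one, abs_sub_comm]
      have : 2 * c / ε = 1 / (ε / (2 * c)) := by field_simp
      rw [this]
      exact one_div_le_one_div_of_le (by positivity) (hl0.trans hk7)
    by_cases hA : ε ≤ ρ x <;> by_cases hB : ε ≤ c * |x - s|
    · simp only [hA, hB, if_true, sub_self, norm_zero]; exact hind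
    · simp only [hA, hB, if_true, if_false, sub_zero]
      push Not at hB
      refine key ?_ ?_
      · rw [le_div_iff₀ hm'0]
        nlinarith [min_le_right m c, abs_nonneg (x - s)]
      · rw [abs_of_neg (a := c * |x - s| - ε) (by linarith),
          abs_of_nonneg (a := ρ x - c * |x - s|) (by linarith)]
        linarith
    · simp only [hA, hB, if_true, if_false, zero_sub, norm_neg]
      push Not at hA
      refine key ?_ ?_
      · rw [le_div_iff₀ hm'0]
        nlinarith [min_le_left m c, abs_nonneg (x - s)]
      · rw [abs_of_nonneg (a := c * |x - s| - ε) (by linarith),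
          abs_of_nonpos (a := ρ x - c * |x - s|) (by linarith)]
        linarith
    · simp only [hA, hB, if_false, sub_self, norm_zero]; exact hind
  have hfinal : ‖∫ x in a..b, ((if ε ≤ ρ x then 1 / (s - x) else 0) -
      (if ε ≤ c * |x - s| then 1 / (s - x) else 0))‖ ≤ volume.real S * (2 * c / ε) := by
    have hi : Integrable (S.indicator fun _ => 2 * c / ε) :=
      (integrable_indicator_iff hSmeas).2 (integrableOn_const hSfin)
    rw [intervalIntegral.integral_of_le hab]
    calc _ ≤ ∫ x in Ioc a b, S.indicator (fun _ => 2 * c / ε) x := by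
          refine norm_integral_le_of_norm_le hi.integrableOn ?_
          filter_upwards [ae_restrict_mem measurableSet_Ioc] with x hx
          exact hbound x (Ioc_subset_Icc_self hx)
      _ ≤ ∫ x, S.indicator (fun _ => 2 * c / ε) x :=
          setIntegral_le_integral hi (ae_of_all _ fun x =>
            indicator_nonneg (fun _ _ => by positivity) x)
      _ = _ := by
          rw [integral_indicator hSmeas, setIntegral_const, smul_eq_mul]
  refine (hfinal.trans (mul_le_mul_of_nonneg_right hvol (by positivity))).trans_lt ?_
  refine lt_of_le_of_lt (le_of_eq ?_) hθe
  rw [hL, hl]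
  field_simp
  ring

/-- Along an injective holomorphic curve `Γ`, the Cauchy kernel `Γ' w / (Γ w - Γ σ)` differs from
the kernel `1 / (w - σ)` by a kernel which is holomorphic in `w`. -/
theorem exists_analytic_integral_regular_kernel {Γ : ℂ → ℂ} {s₀ r d : ℝ} (hr : 0 < r)
    (hΓ : DifferentiableOn ℂ Γ (Metric.ball (s₀ : ℂ) r))
    (hinj : InjOn Γ (Metric.ball (s₀ : ℂ) r))
    (hΓ' : ∀ z ∈ Metric.ball (s₀ : ℂ) r, deriv Γ z ≠ 0)
    {g : ℝ → ℝ} (hg : Continuous g) (hd : 0 < d) (hdr : d ≤ r / 4) :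
    ∃ R : ℂ → ℂ, AnalyticOnNhd ℂ R (Metric.ball (s₀ : ℂ) (r / 2)) ∧
      ∀ s : ℝ, (s : ℂ) ∈ Metric.ball (s₀ : ℂ) (r / 2) →
        IntervalIntegrable (fun σ : ℝ => (g σ : ℂ) * (deriv Γ s / (Γ s - Γ σ) - 1 / (s - σ)))
          volume (s₀ - d) (s₀ + d) ∧
        R s = ∫ σ in (s₀ - d)..(s₀ + d),
          (g σ : ℂ) * (deriv Γ s / (Γ s - Γ σ) - 1 / (s - σ)) := by
  set D := Metric.ball (s₀ : ℂ) r with hD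
  have hDo : IsOpen D := Metric.isOpen_ball
  set K : ℂ → ℂ → ℂ := fun σ w => deriv (dslope Γ σ) w / dslope Γ σ w with hK
  have hsub : ∀ {σ : ℝ}, σ ∈ Icc (s₀ - d) (s₀ + d) →
      (σ : ℂ) ∈ Metric.closedBall (s₀ : ℂ) (r / 4) := fun {σ} hσ => by
    rw [Metric.mem_closedBall, Complex.dist_eq, ← Complex.ofReal_sub, Complex.norm_real,
      Real.norm_eq_abs, abs_le]
    constructor <;> linarith [hσ.1, hσ.2]
  have h4D : Metric.closedBall (s₀ : ℂ) (r / 4) ⊆ D :=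
    Metric.closedBall_subset_ball (by linarith)
  have h2D : Metric.closedBall (s₀ : ℂ) (r / 2) ⊆ D :=
    Metric.closedBall_subset_ball (by linarith)
  have hdiff : ∀ σ ∈ D, DifferentiableOn ℂ (dslope Γ σ) D := fun σ hσ =>
    (Complex.differentiableOn_dslope (hDo.mem_nhds hσ)).2 hΓ
  have hne : ∀ σ ∈ D, ∀ w ∈ D, dslope Γ σ w ≠ 0 := fun σ hσ w hw => by
    rcases eq_or_ne w σ with rfl | h
    · rw [dslope_same]; exact hΓ' _ hσ
    · rw [dslope_of_ne _ h, slope_def_field]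
      exact div_ne_zero (sub_ne_zero.2 fun h' => h (hinj hw hσ h')) (sub_ne_zero.2 h)
  have hKdiff : ∀ σ ∈ D, DifferentiableOn ℂ (K σ) D := fun σ hσ =>
    ((hdiff σ hσ).deriv hDo).div (hdiff σ hσ) (hne σ hσ)
  have hKeq : ∀ σ ∈ D, ∀ w ∈ D, w ≠ σ →
      K σ w = deriv Γ w / (Γ w - Γ σ) - 1 / (w - σ) := fun σ hσ w hw h => by
    have h1 : Γ w - Γ σ ≠ 0 := sub_ne_zero.2 fun h' => h (hinj hw hσ h')
    have h2 : w - σ ≠ 0 := sub_ne_zero.2 h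
    have h3 : dslope Γ σ =ᶠ[𝓝 w] fun z => (Γ z - Γ σ) / (z - σ) := by
      filter_upwards [isOpen_ne.mem_nhds h] with z hz
      rw [dslope_of_ne _ hz, slope_def_field]
    have h4 : HasDerivAt (fun z => (Γ z - Γ σ) / (z - σ))
        ((deriv Γ w * (w - σ) - (Γ w - Γ σ) * 1) / (w - σ) ^ 2) w :=
      (((hΓ.differentiableAt (hDo.mem_nhds hw)).hasDerivAt).sub_const _).div
        ((hasDerivAt_id w).sub_const _) h2
    simp only [hK]
    rw [h3.deriv_eq, h4.deriv, h3.self_of_nhds]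
    field_simp
  obtain ⟨C, hC⟩ : ∃ C, ∀ σ ∈ Metric.closedBall (s₀ : ℂ) (r / 4),
      ∀ w ∈ Metric.sphere (s₀ : ℂ) (r / 2), ‖K σ w‖ ≤ C := by
    have hcpt : IsCompact (Metric.closedBall (s₀ : ℂ) (r / 4) ×ˢ Metric.sphere (s₀ : ℂ) (r / 2)) :=
      (isCompact_closedBall _ _).prod (isCompact_sphere _ _)
    have hmaps1 : ∀ q ∈ Metric.closedBall (s₀ : ℂ) (r / 4) ×ˢ Metric.sphere (s₀ : ℂ) (r / 2),
        q.1 ∈ D ∧ q.2 ∈ D ∧ q.2 ≠ q.1 := fun q hq => by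
      refine ⟨h4D hq.1, h2D (Metric.sphere_subset_closedBall hq.2), fun h => ?_⟩
      have h1 := Metric.mem_closedBall.1 hq.1
      have h2 := Metric.mem_sphere.1 hq.2
      rw [h] at h2
      linarith
    have hcont : ContinuousOn (fun q : ℂ × ℂ => deriv Γ q.2 / (Γ q.2 - Γ q.1) - 1 / (q.2 - q.1))
        (Metric.closedBall (s₀ : ℂ) (r / 4) ×ˢ Metric.sphere (s₀ : ℂ) (r / 2)) := by
      have c1 := ((hΓ.deriv hDo).continuousOn).comp continuousOn_snd fun q hq => (hmaps1 q hq).2.1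
      have c2 := (hΓ.continuousOn).comp continuousOn_snd fun q hq => (hmaps1 q hq).2.1
      have c3 := (hΓ.continuousOn).comp continuousOn_fst fun q hq => (hmaps1 q hq).1
      refine (c1.div (c2.sub c3) fun q hq => ?_).sub
        (continuousOn_const.div (continuousOn_snd.sub continuousOn_fst) fun q hq => ?_)
      · obtain ⟨a1, a2, a3⟩ := hmaps1 q hq
        exact sub_ne_zero.2 fun h => a3 (hinj a2 a1 h)
      · exact sub_ne_zero.2 (hmaps1 q hq).2.2
    obtain ⟨C, hC⟩ := hcpt.exists_bound_of_continuousOn hcont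
    refine ⟨C, fun σ hσ w hw => ?_⟩
    obtain ⟨a1, a2, a3⟩ := hmaps1 (σ, w) ⟨hσ, hw⟩
    rw [hKeq σ a1 w a2 a3]
    exact hC (σ, w) ⟨hσ, hw⟩
  have hC2 : ∀ σ ∈ Metric.closedBall (s₀ : ℂ) (r / 4),
      ∀ w ∈ Metric.ball (s₀ : ℂ) (r / 2), ‖K σ w‖ ≤ C := by
    intro σ hσ w hw
    refine Complex.norm_le_of_forall_mem_frontier_norm_le (U := Metric.ball (s₀ : ℂ) (r / 2))
      Metric.isBounded_ball ?_ ?_ (subset_closure hw)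
    · refine DifferentiableOn.diffContOnCl ?_
      exact (hKdiff σ (h4D hσ)).mono (Metric.closure_ball_subset_closedBall.trans h2D)
    · rw [frontier_ball _ (by positivity)]
      exact hC σ hσ
  obtain ⟨G, hG⟩ := isCompact_Icc.exists_bound_of_continuousOn
    (hg.continuousOn (s := Icc (s₀ - d) (s₀ + d)))
  have hle : s₀ - d ≤ s₀ + d := by linarith
  have hfin : IsFiniteMeasure (volume.restrict (Ioc (s₀ - d) (s₀ + d))) := by infer_instance
  have hmeas : ∀ w ∈ D, AEStronglyMeasurable
      (fun σ : ℝ => (g σ : ℂ) * (deriv Γ w / (Γ w - Γ σ) - 1 / (w - σ)))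
      (volume.restrict (Ioc (s₀ - d) (s₀ + d))) := by
    intro w hw
    have hΓm : AEMeasurable (fun σ : ℝ => Γ σ) (volume.restrict (Ioc (s₀ - d) (s₀ + d))) := by
      refine ContinuousOn.aemeasurable ?_ measurableSet_Ioc
      exact hΓ.continuousOn.comp Complex.continuous_ofReal.continuousOn
        fun σ hσ => h4D (hsub (Ioc_subset_Icc_self hσ))
    have hgm : Measurable g := hg.measurable
    refine AEMeasurable.aestronglyMeasurable ?_
    exact (Complex.measurable_ofReal.comp hgm).aemeasurable.mul
      (((hΓm.const_sub _).const_div _).sub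
        ((Complex.measurable_ofReal.const_sub w).const_div 1).aemeasurable)
  have hae : ∀ w : ℂ, ∀ᵐ σ : ℝ, w ≠ σ := by
    intro w
    have : ∀ᵐ σ : ℝ, σ ≠ w.re := by simp [ae_iff]
    filter_upwards [this] with σ hσ h
    exact hσ (by rw [h, Complex.ofReal_re])
  have haeq : ∀ w ∈ D, (fun σ : ℝ => (g σ : ℂ) * (deriv Γ w / (Γ w - Γ σ) - 1 / (w - σ)))
      =ᵐ[volume.restrict (Ioc (s₀ - d) (s₀ + d))] fun σ : ℝ => (g σ : ℂ) * K σ w := by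
    intro w hw
    filter_upwards [ae_restrict_of_ae (hae w), ae_restrict_mem measurableSet_Ioc] with σ h1 h2
    rw [hKeq σ (h4D (hsub (Ioc_subset_Icc_self h2))) w hw h1]
  have hbd : ∀ σ ∈ Ioc (s₀ - d) (s₀ + d), ∀ w ∈ Metric.ball (s₀ : ℂ) (r / 2),
      ‖(g σ : ℂ) * K σ w‖ ≤ G * C := by
    intro σ hσ w hw
    have h1 := hG σ (Ioc_subset_Icc_self hσ)
    have h2 := hC2 σ (hsub (Ioc_subset_Icc_self hσ)) w hw
    rw [norm_mul, Complex.norm_real]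
    exact mul_le_mul h1 h2 (norm_nonneg _) ((norm_nonneg _).trans h1)
  have hKm : ∀ w ∈ D, AEStronglyMeasurable (fun σ : ℝ => (g σ : ℂ) * K σ w)
      (volume.restrict (Ioc (s₀ - d) (s₀ + d))) := fun w hw => (hmeas w hw).congr (haeq w hw)
  have h2D' : Metric.ball (s₀ : ℂ) (r / 2) ⊆ D := Metric.ball_subset_closedBall.trans h2D
  refine ⟨fun w => ∫ σ in Ioc (s₀ - d) (s₀ + d), (g σ : ℂ) * K σ w, ?_, fun s hs => ⟨?_, ?_⟩⟩
  · refine DifferentiableOn.analyticOnNhd ?_ Metric.isOpen_ball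
    refine differentiableOn_integral_of_bounded Metric.isOpen_ball
      (K := fun w (σ : ℝ) => (g σ : ℂ) * K σ w) (C := G * C) ?_ ?_ ?_
    · filter_upwards [ae_restrict_mem measurableSet_Ioc] with σ hσ
      exact (((hKdiff σ (h4D (hsub (Ioc_subset_Icc_self hσ)))).mono h2D').const_mul _)
    · exact fun w hw => hKm w (h2D' hw)
    · filter_upwards [ae_restrict_mem measurableSet_Ioc] with σ hσ
      exact hbd σ hσ
  · rw [intervalIntegrable_iff_integrableOn_Ioc_of_le hle]
    refine Integrable.congr ?_ (haeq s (h2D' hs)).symm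
    refine Integrable.of_bound (hKm s (h2D' hs)) (G * C) ?_
    filter_upwards [ae_restrict_mem measurableSet_Ioc] with σ hσ
    exact hbd σ hσ s hs
  · rw [intervalIntegral.integral_of_le hle]
    exact (integral_congr_ae (haeq s (h2D' hs))).symm

theorem IntervalIntegrable.truncation {α β ε : ℝ} {F ρ : ℝ → ℝ}
    (hF : IntervalIntegrable F volume α β) (hρ : Measurable ρ) :
    IntervalIntegrable (fun x => if ε ≤ ρ x then F x else 0) volume α β := by
  rw [intervalIntegrable_iff] at hF ⊢
  refine (Integrable.indicator hF (measurableSet_le (measurable_const (a := ε)) hρ)).congr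
    (ae_of_all _ fun x => ?_)
  simp [indicator]

theorem tendsto_integral_truncation_re {α β : ℝ} {F : ℝ → ℂ} {ρ : ℝ → ℝ}
    (hF : IntervalIntegrable F volume α β) (hρ : Measurable ρ)
    (hpos : ∀ᵐ x : ℝ, x ∈ uIoc α β → 0 < ρ x) :
    Tendsto (fun ε : ℝ => ∫ x in α..β, if ε ≤ ρ x then (F x).re else 0) (𝓝[>] 0)
      (𝓝 (∫ x in α..β, F x).re) := by
  have hre : IntervalIntegrable (fun x => (F x).re) volume α β :=
    ⟨hF.1.re, hF.2.re⟩
  have h := tendsto_integral_truncation hre hρ hpos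
  have : ∫ x in α..β, (F x).re = (∫ x in α..β, F x).re :=
    Complex.reCLM.intervalIntegral_comp_comm hF
  rwa [this] at h

/-- The principal value of the Cauchy integral over a short arc of a curve, in terms of the
principal value over the parameter interval. -/
theorem tendsto_integral_truncation_cauchy_kernel {a b s m M : ℝ} {p : ℝ → ℂ} {v : ℂ} {g : ℝ → ℝ}
    (hs : s ∈ Ioo a b) (hp : Measurable p) (hv : v ≠ 0) (hpv : HasDerivAt p v s) (hm : 0 < m)
    (hlow : ∀ x ∈ Icc a b, m * |x - s| ≤ ‖p s - p x‖)
    (hM : ∀ x ∈ Icc a b, ‖p s - p x‖ ≤ M * |x - s|)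
    (hg : Continuous g) (hgs : DifferentiableAt ℝ g s)
    (hInt : IntervalIntegrable (fun σ : ℝ => (g σ : ℂ) * (v / (p s - p σ) - 1 / (s - σ)))
      volume a b) :
    (∀ ε > 0, IntervalIntegrable (fun σ => if ε ≤ ‖p s - p σ‖ then
      ((g σ : ℂ) * (v / (p s - p σ))).re else 0) volume a b) ∧
    Tendsto (fun ε : ℝ => ∫ σ in a..b, if ε ≤ ‖p s - p σ‖ then
        ((g σ : ℂ) * (v / (p s - p σ))).re else 0) (𝓝[>] 0)
      (𝓝 ((∫ σ in a..b, (g σ : ℂ) * (v / (p s - p σ) - 1 / (s - σ))).re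
        - (∫ σ in a..b, dslope g s σ) + g s * (Real.log (s - a) - Real.log (b - s)))) := by
  have hab : a ≤ b := (hs.1.trans hs.2).le
  have hρ : Measurable fun σ => ‖p s - p σ‖ := (hp.const_sub _).norm
  have hnes : ∀ᵐ x : ℝ, x ≠ s := by simp [ae_iff]
  have hpos : ∀ᵐ x : ℝ, x ∈ uIoc a b → 0 < ‖p s - p x‖ := by
    filter_upwards [hnes] with x hx hxm
    rw [uIoc_of_le hab] at hxm
    exact lt_of_lt_of_le (mul_pos hm (abs_pos.2 (sub_ne_zero.2 hx)))
      (hlow x (Ioc_subset_Icc_self hxm))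
  have hds : IntervalIntegrable (dslope g s) volume a b := by
    refine ContinuousOn.intervalIntegrable ?_
    rw [uIcc_of_le hab]
    exact (continuousOn_dslope (Icc_mem_nhds hs.1 hs.2)).2 ⟨hg.continuousOn, hgs⟩
  have ho : (fun x => ‖p s - p x‖ - ‖v‖ * |x - s|) =o[𝓝 s] fun x => x - s := by
    refine Asymptotics.IsBigO.trans_isLittleO (Asymptotics.IsBigO.of_bound' ?_)
      (hasDerivAt_iff_isLittleO.1 hpv)
    refine Eventually.of_forall fun x => ?_
    rw [Real.norm_eq_abs, norm_sub_rev, mul_comm, ← Real.norm_eq_abs (x - s), ← norm_smul]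
    exact abs_norm_sub_norm_le _ _
  have hre : IntervalIntegrable
      (fun σ : ℝ => ((g σ : ℂ) * (v / (p s - p σ) - 1 / (s - σ))).re) volume a b :=
    ⟨hInt.1.re, hInt.2.re⟩
  have hT : ∀ ε > 0, IntervalIntegrable (fun σ => if ε ≤ ‖p s - p σ‖ then 1 / (s - σ) else 0)
      volume a b := fun ε hε =>
    intervalIntegrable_truncation hε hρ (M := M) (by rwa [uIcc_of_le hab])
  have hae : ∀ ε : ℝ, (fun σ => if ε ≤ ‖p s - p σ‖ then
        ((g σ : ℂ) * (v / (p s - p σ) - 1 / (s - σ))).re else 0) -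
      (fun σ => if ε ≤ ‖p s - p σ‖ then dslope g s σ else 0) +
      (fun σ => g s * if ε ≤ ‖p s - p σ‖ then 1 / (s - σ) else 0) =ᵐ[volume]
      fun σ => if ε ≤ ‖p s - p σ‖ then ((g σ : ℂ) * (v / (p s - p σ))).re else 0 := by
    intro ε
    filter_upwards [hnes] with x hx
    simp only [Pi.add_apply, Pi.sub_apply]
    split_ifs with h
    · rw [dslope_of_ne _ hx, slope_def_field, ← Complex.ofReal_sub, ← Complex.ofReal_one,
        ← Complex.ofReal_div, Complex.re_ofReal_mul, Complex.re_ofReal_mul, Complex.sub_re,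
        Complex.ofReal_re]
      have h1 : x - s ≠ 0 := sub_ne_zero.2 hx
      have h2 : s - x ≠ 0 := sub_ne_zero.2 hx.symm
      have : (g x - g s) / (x - s) = (g s - g x) * (1 / (s - x)) := by
        field_simp; ring
      rw [this]
      ring
    · simp
  have hi : ∀ ε > 0, IntervalIntegrable ((fun σ => if ε ≤ ‖p s - p σ‖ then
        ((g σ : ℂ) * (v / (p s - p σ) - 1 / (s - σ))).re else 0) -
      (fun σ => if ε ≤ ‖p s - p σ‖ then dslope g s σ else 0)) volume a b := fun ε _ =>
    (hre.truncation hρ).sub (hds.truncation hρ)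
  refine ⟨fun ε hε => ?_, ?_⟩
  · exact ((hi ε hε).add ((hT ε hε).const_mul (g s))).congr_ae (ae_restrict_of_ae (hae ε))
  · refine Tendsto.congr' ?_ (((tendsto_integral_truncation_re hInt hρ hpos).sub
      (tendsto_integral_truncation hds hρ hpos)).add
      ((tendsto_integral_truncation_inv hs (norm_pos_iff.2 hv) hm hρ hlow hM ho).const_mul (g s)))
    filter_upwards [self_mem_nhdsWithin] with ε hε
    rw [← intervalIntegral.integral_const_mul]
    refine (congrArg (· + _) (intervalIntegral.integral_sub (hre.truncation hρ)
      (hds.truncation hρ)).symm).trans ((intervalIntegral.integral_add (hi ε hε)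
      ((hT ε hε).const_mul (g s))).symm.trans ?_)
    refine intervalIntegral.integral_congr_ae ?_
    filter_upwards [hae ε] with x hx _
    exact hx

/-- Along an analytic curve, the principal value of the Cauchy integral is, up to an analytic
function, the principal value over a short parameter interval. -/
theorem exists_analyticAt_principal_value {p : ℝ → ℂ} {Γ : ℂ → ℂ} {s₀ r d L m M : ℝ} {g : ℝ → ℝ}
    (hp : Continuous p) (hr : 0 < r) (hΓ : DifferentiableOn ℂ Γ (Metric.ball (s₀ : ℂ) r))
    (hm : 0 < m)
    (hlow : ∀ z ∈ Metric.ball (s₀ : ℂ) r, ∀ w ∈ Metric.ball (s₀ : ℂ) r,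
      m * ‖z - w‖ ≤ ‖Γ z - Γ w‖)
    (hM : ∀ z ∈ Metric.ball (s₀ : ℂ) r, ∀ w ∈ Metric.ball (s₀ : ℂ) r,
      ‖Γ z - Γ w‖ ≤ M * ‖z - w‖)
    (hΓ' : ∀ z ∈ Metric.ball (s₀ : ℂ) r, deriv Γ z ≠ 0)
    (hpΓ : ∀ s : ℝ, (s : ℂ) ∈ Metric.ball (s₀ : ℂ) r → Γ s = p s)
    (hg : ContDiff ℝ 1 g) (hd : 0 < d) (hdr : d ≤ r / 4) (hdL : d ≤ L)
    (hfar : ∀ σ ∈ Icc (s₀ - L) (s₀ + L), σ ∉ Ioo (s₀ - d) (s₀ + d) → p σ ≠ p s₀) :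
    ∃ R : ℂ → ℂ, AnalyticAt ℂ R s₀ ∧ ∀ᶠ s : ℝ in 𝓝 s₀,
      Tendsto (fun ε : ℝ => ∫ σ in (s₀ - L)..(s₀ + L), if ε ≤ ‖p s - p σ‖ then
          ((g σ : ℂ) * (deriv Γ s / (p s - p σ))).re else 0) (𝓝[>] 0)
        (𝓝 ((R s).re - (∫ σ in (s₀ - d)..(s₀ + d), dslope g s σ) +
          g s * (Real.log (s - (s₀ - d)) - Real.log (s₀ + d - s)))) := by
  have hinj : InjOn Γ (Metric.ball (s₀ : ℂ) r) := fun z hz w hw h => by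
    have := hlow z hz w hw
    rw [h, sub_self, norm_zero] at this
    have h2 : ‖z - w‖ ≤ 0 := by nlinarith [norm_nonneg (z - w)]
    exact sub_eq_zero.1 (norm_le_zero_iff.1 h2)
  obtain ⟨R₀, hR₀, hR₀'⟩ := exists_analytic_integral_regular_kernel hr hΓ hinj hΓ'
    hg.continuous hd hdr
  have hmem : ∀ {s : ℝ}, |s - s₀| < r → (s : ℂ) ∈ Metric.ball (s₀ : ℂ) r := fun {s} hs => by
    rwa [Metric.mem_ball, Complex.dist_eq, ← Complex.ofReal_sub, Complex.norm_real,
      Real.norm_eq_abs]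
  have hs₀ : (s₀ : ℂ) ∈ Metric.ball (s₀ : ℂ) r := Metric.mem_ball_self hr
  have hΓan : AnalyticAt ℂ Γ s₀ := hΓ.analyticAt (Metric.ball_mem_nhds _ hr)
  have hgC : Continuous fun σ => (g σ : ℂ) := Complex.continuous_ofReal.comp hg.continuous
  set far : Set ℝ := Icc (s₀ - L) (s₀ - d) ∪ Icc (s₀ + d) (s₀ + L) with hfardef
  have hfar' : ∀ σ ∈ far, p σ ≠ p s₀ := by
    rintro σ (h | h)
    · exact hfar σ ⟨h.1, by linarith [h.2]⟩ fun h' => by linarith [h.2, h'.1]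
    · exact hfar σ ⟨by linarith [h.1], h.2⟩ fun h' => by linarith [h.1, h'.2]
  have hl : uIcc (s₀ - L) (s₀ - d) ⊆ far := by
    rw [uIcc_of_le (by linarith)]; exact subset_union_left
  have hr' : uIcc (s₀ + d) (s₀ + L) ⊆ far := by
    rw [uIcc_of_le (by linarith)]; exact subset_union_right
  have hfarJ : ∀ᶠ s : ℝ in 𝓝 s₀, ∀ σ ∈ far, p σ ≠ p s := by
    have hc : IsCompact (p '' far) := (isCompact_Icc.union isCompact_Icc).image hp
    have : ∀ᶠ s : ℝ in 𝓝 s₀, p s ∈ (p '' far)ᶜ := by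
      refine hp.continuousAt.eventually_mem (hc.isClosed.isOpen_compl.mem_nhds ?_)
      rintro ⟨σ, hσ, h⟩
      exact hfar' σ hσ h
    filter_upwards [this] with s hs σ hσ h
    exact hs ⟨σ, hσ, h⟩
  have hJ : ∀ {α β : ℝ}, uIcc α β ⊆ far →
      AnalyticAt ℂ (fun w => ∫ σ in α..β, (g σ : ℂ) / (p σ - w)) (Γ s₀) := fun hαβ => by
    refine analyticAt_integral_div_sub hgC.continuousOn hp.continuousOn fun y hy => ?_
    rw [hpΓ s₀ hs₀]
    exact hfar' y (hαβ hy)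
  -- the contribution of an arc away from the singularity
  have harc : ∀ {α β s : ℝ}, uIcc α β ⊆ far → Γ s = p s → (∀ σ ∈ far, p σ ≠ p s) →
      IntervalIntegrable (fun σ => (g σ : ℂ) * (deriv Γ s / (p s - p σ))) volume α β ∧
      ∫ σ in α..β, (g σ : ℂ) * (deriv Γ s / (p s - p σ)) =
        -deriv Γ s * ∫ σ in α..β, (g σ : ℂ) / (p σ - Γ s) := by
    intro α β s hαβ hs hne
    refine ⟨ContinuousOn.intervalIntegrable ?_, ?_⟩
    · refine hgC.continuousOn.mul (continuousOn_const.div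
        (continuousOn_const.sub hp.continuousOn) fun σ hσ => ?_)
      exact sub_ne_zero.2 (hne σ (hαβ hσ)).symm
    · rw [← intervalIntegral.integral_const_mul, hs]
      refine intervalIntegral.integral_congr fun σ hσ => ?_
      have h1 := sub_ne_zero.2 (hne σ (hαβ hσ))
      have h2 := sub_ne_zero.2 (hne σ (hαβ hσ)).symm
      field_simp
      ring
  refine ⟨fun w => -deriv Γ w * (∫ σ in (s₀ - L)..(s₀ - d), (g σ : ℂ) / (p σ - Γ w)) + R₀ w +
    -deriv Γ w * (∫ σ in (s₀ + d)..(s₀ + L), (g σ : ℂ) / (p σ - Γ w)), ?_, ?_⟩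
  · refine ((hΓan.deriv.neg.mul ?_).add (hR₀ _ (Metric.mem_ball_self (by positivity)))).add
      (hΓan.deriv.neg.mul ?_)
    · exact AnalyticAt.fun_comp (g := fun w => ∫ σ in (s₀ - L)..(s₀ - d), (g σ : ℂ) / (p σ - w))
        (hJ hl) hΓan
    · exact AnalyticAt.fun_comp (g := fun w => ∫ σ in (s₀ + d)..(s₀ + L), (g σ : ℂ) / (p σ - w))
        (hJ hr') hΓan
  have hnear : ∀ᶠ s : ℝ in 𝓝 s₀, |s - s₀| < d := by
    filter_upwards [Metric.ball_mem_nhds s₀ hd] with s hs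
    rwa [Metric.mem_ball, Real.dist_eq] at hs
  filter_upwards [hfarJ, hnear] with s hne hsd
  have hsr := hmem (hsd.trans (by linarith))
  have hs2 : (s : ℂ) ∈ Metric.ball (s₀ : ℂ) (r / 2) := by
    rw [Metric.mem_ball, Complex.dist_eq, ← Complex.ofReal_sub, Complex.norm_real,
      Real.norm_eq_abs]
    linarith
  obtain ⟨hsd1, hsd2⟩ := abs_lt.1 hsd
  have hsmem : s ∈ Ioo (s₀ - d) (s₀ + d) := ⟨by linarith, by linarith⟩
  have hσr : ∀ x ∈ Icc (s₀ - d) (s₀ + d), (x : ℂ) ∈ Metric.ball (s₀ : ℂ) r := fun x hx =>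
    hmem (by rw [abs_lt]; constructor <;> linarith [hx.1, hx.2])
  have hρ : Measurable fun σ => ‖p s - p σ‖ := (hp.measurable.const_sub _).norm
  obtain ⟨hi, hR⟩ := hR₀' s hs2
  have hcongr : EqOn (fun σ : ℝ => (g σ : ℂ) * (deriv Γ s / (Γ s - Γ σ) - 1 / (s - σ)))
      (fun σ : ℝ => (g σ : ℂ) * (deriv Γ s / (p s - p σ) - 1 / (s - σ)))
      (uIcc (s₀ - d) (s₀ + d)) := fun σ hσ => by
    rw [uIcc_of_le (by linarith)] at hσ
    simp only [hpΓ s hsr, hpΓ σ (hσr σ hσ)]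
  have hpv : HasDerivAt p (deriv Γ s) s := by
    have h1 := ((hΓ.differentiableAt (Metric.isOpen_ball.mem_nhds hsr)).hasDerivAt).comp_ofReal
    refine h1.congr_of_eventuallyEq ?_
    filter_upwards [Ioo_mem_nhds hsmem.1 hsmem.2] with x hx
    exact (hpΓ x (hσr x (Ioo_subset_Icc_self hx))).symm
  have hnorm : ∀ x : ℝ, ‖(s : ℂ) - x‖ = |x - s| := fun x => by
    rw [← Complex.ofReal_sub, Complex.norm_real, Real.norm_eq_abs, abs_sub_comm]
  obtain ⟨hmi, hmt⟩ := tendsto_integral_truncation_cauchy_kernel (m := m) (M := M) hsmem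
    hp.measurable (hΓ' s hsr) hpv hm
    (fun x hx => by
      rw [← hpΓ s hsr, ← hpΓ x (hσr x hx), ← hnorm]; exact hlow _ hsr _ (hσr x hx))
    (fun x hx => by
      rw [← hpΓ s hsr, ← hpΓ x (hσr x hx), ← hnorm]; exact hM _ hsr _ (hσr x hx))
    hg.continuous (hg.differentiable (by norm_num) s)
    (hi.congr_ae (by
      filter_upwards [ae_restrict_mem measurableSet_uIoc] with x hx
      exact hcongr (uIoc_subset_uIcc hx)))
  obtain ⟨li, le⟩ := harc hl (hpΓ s hsr) hne
  obtain ⟨ri, re⟩ := harc hr' (hpΓ s hsr) hne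
  have hpos : ∀ σ ∈ far, 0 < ‖p s - p σ‖ := fun σ hσ =>
    norm_pos_iff.2 (sub_ne_zero.2 (hne σ hσ).symm)
  have hlt := tendsto_integral_truncation_re li hρ
    (ae_of_all _ fun x hx => hpos x (hl (uIoc_subset_uIcc hx)))
  have hrt := tendsto_integral_truncation_re ri hρ
    (ae_of_all _ fun x hx => hpos x (hr' (uIoc_subset_uIcc hx)))
  rw [← intervalIntegral.integral_congr hcongr, ← hR] at hmt
  rw [le] at hlt
  rw [re] at hrt
  have htot := (hlt.add hmt).add hrt
  simp only [Complex.add_re]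
  refine Tendsto.congr' ?_ (htot.trans (le_of_eq ?_))
  · filter_upwards [self_mem_nhdsWithin] with ε hε
    have hli : IntervalIntegrable (fun σ => if ε ≤ ‖p s - p σ‖ then
        ((g σ : ℂ) * (deriv Γ s / (p s - p σ))).re else 0) volume (s₀ - L) (s₀ - d) :=
      IntervalIntegrable.truncation (F := fun σ => ((g σ : ℂ) * (deriv Γ s / (p s - p σ))).re)
        ⟨li.1.re, li.2.re⟩ hρ
    have hri : IntervalIntegrable (fun σ => if ε ≤ ‖p s - p σ‖ then
        ((g σ : ℂ) * (deriv Γ s / (p s - p σ))).re else 0) volume (s₀ + d) (s₀ + L) :=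
      IntervalIntegrable.truncation (F := fun σ => ((g σ : ℂ) * (deriv Γ s / (p s - p σ))).re)
        ⟨ri.1.re, ri.2.re⟩ hρ
    rw [intervalIntegral.integral_add_adjacent_intervals hli (hmi ε hε),
      intervalIntegral.integral_add_adjacent_intervals (hli.trans (hmi ε hε)) hri]
  · congr 1
    ring

/-- If a holomorphic function in a half-disc has boundary values `u ∓ i g` in the parameter of an
analytic curve, then `u` and the principal value of the Cauchy integral of `g` along the curve
agree up to a real analytic function. -/
theorem analyticAt_sub_principal_value {p : ℝ → ℂ} {Γ : ℂ → ℂ} {s₀ r L m M κ : ℝ} {u g P : ℝ → ℝ}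
    (hp : Continuous p) (hr : 0 < r) (hΓ : DifferentiableOn ℂ Γ (Metric.ball (s₀ : ℂ) r))
    (hm : 0 < m)
    (hlow : ∀ z ∈ Metric.ball (s₀ : ℂ) r, ∀ w ∈ Metric.ball (s₀ : ℂ) r,
      m * ‖z - w‖ ≤ ‖Γ z - Γ w‖)
    (hM : ∀ z ∈ Metric.ball (s₀ : ℂ) r, ∀ w ∈ Metric.ball (s₀ : ℂ) r,
      ‖Γ z - Γ w‖ ≤ M * ‖z - w‖)
    (hΓ' : ∀ z ∈ Metric.ball (s₀ : ℂ) r, deriv Γ z ≠ 0)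
    (hpΓ : ∀ s : ℝ, (s : ℂ) ∈ Metric.ball (s₀ : ℂ) r → Γ s = p s)
    (hu : Differentiable ℝ u) (hg : ContDiff ℝ 1 g) (hrL : r ≤ L)
    (hfar : ∀ σ ∈ Icc (s₀ - L) (s₀ + L), p σ = p s₀ → σ = s₀)
    (hP : ∀ s : ℝ, (s : ℂ) ∈ Metric.ball (s₀ : ℂ) r → Tendsto (fun ε : ℝ =>
      ∫ σ in (s₀ - L)..(s₀ + L), if ε ≤ ‖p s - p σ‖ then
        ((g σ : ℂ) * (deriv Γ s / (p s - p σ))).re else 0) (𝓝[>] 0) (𝓝 (P s)))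
    {Φ : ℂ → ℂ} (hκ : κ = 1 ∨ κ = -1)
    (hΦc : ContinuousOn Φ (Metric.ball (s₀ : ℂ) r ∩ {z | 0 ≤ κ * z.im}))
    (hΦd : ∀ z ∈ Metric.ball (s₀ : ℂ) r, 0 < κ * z.im → DifferentiableAt ℂ Φ z)
    (hΦ : ∀ s : ℝ, (s : ℂ) ∈ Metric.ball (s₀ : ℂ) r → Φ s = u s - κ * g s * Complex.I) :
    AnalyticAt ℝ (fun s => Real.pi * u s - P s) s₀ := by
  set d := r / 4 with hd
  have hd0 : 0 < d := by positivity
  obtain ⟨R, hR, hRlim⟩ := exists_analyticAt_principal_value (d := d) (L := L) hp hr hΓ hm hlow hM hΓ'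
    hpΓ hg hd0 le_rfl (by linarith) fun σ hσ hσ' h => hσ' (by
      rw [hfar σ hσ h]; constructor <;> linarith)
  have hball : ∀ z : ℂ, z ∈ Icc (s₀ - d) (s₀ + d) ×ℂ Icc (-d) d →
      z ∈ Metric.ball (s₀ : ℂ) r := by
    intro z hz
    obtain ⟨h1, h2⟩ := Complex.mem_reProdIm.1 hz
    rw [Metric.mem_ball, Complex.dist_eq]
    refine (Complex.norm_le_abs_re_add_abs_im _).trans_lt ?_
    have h3 : |(z - s₀).re| ≤ d := by
      rw [Complex.sub_re, Complex.ofReal_re, abs_le]; constructor <;> linarith [h1.1, h1.2]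
    have h4 : |(z - s₀).im| ≤ d := by
      rw [Complex.sub_im, Complex.ofReal_im, sub_zero, abs_le]; exact h2
    linarith
  have hre : ∀ x ∈ Icc (s₀ - d) (s₀ + d), (x : ℂ) ∈ Metric.ball (s₀ : ℂ) r := fun x hx =>
    hball x (Complex.mem_reProdIm.2 ⟨by simpa using hx, by simp [hd0.le]⟩)
  obtain ⟨A, hA⟩ : ∃ A : ℂ → ℂ, ∀ s ∈ Ioo (s₀ - d) (s₀ + d), AnalyticAt ℂ A s ∧
      Real.pi * u s = -(∫ x in (s₀ - d)..(s₀ + d), dslope g s x) +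
        g s * (Real.log (s - (s₀ - d)) - Real.log (s₀ + d - s)) + (A s).im := by
    have hgd := hg.differentiable (by norm_num)
    rcases hκ with rfl | rfl
    · refine exists_analyticAt_boundary_value (Φ := Φ) (by linarith) hd0 (hΦc.mono ?_) ?_ hu hgd ?_
      · intro z hz
        obtain ⟨h1, h2⟩ := Complex.mem_reProdIm.1 hz
        refine ⟨hball z (Complex.mem_reProdIm.2 ⟨h1, by linarith [h2.1], h2.2⟩), ?_⟩
        simpa using h2.1
      · intro z hz
        obtain ⟨h1, h2⟩ := Complex.mem_reProdIm.1 hz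
        refine (hΦd z (hball z (Complex.mem_reProdIm.2 ⟨Ioo_subset_Icc_self h1,
          by linarith [h2.1], h2.2.le⟩)) ?_).differentiableWithinAt
        simpa using h2.1
      · intro x hx
        rw [hΦ x (hre x hx)]; simp
    · refine exists_analyticAt_boundary_value
        (Φ := fun z => starRingEnd ℂ (Φ (starRingEnd ℂ z)))
        (by linarith) hd0 ?_ ?_ hu hgd ?_
      · refine Complex.continuous_conj.comp_continuousOn
          (hΦc.comp Complex.continuous_conj.continuousOn fun z hz => ?_)
        obtain ⟨h1, h2⟩ := Complex.mem_reProdIm.1 hz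
        refine ⟨hball _ (Complex.mem_reProdIm.2 ⟨?_, ?_⟩), ?_⟩
        · simpa using h1
        · rw [Complex.conj_im]; constructor <;> linarith [h2.1, h2.2]
        · simpa using h2.1
      · intro z hz
        obtain ⟨h1, h2⟩ := Complex.mem_reProdIm.1 hz
        refine DifferentiableAt.differentiableWithinAt ?_
        have h3 : DifferentiableAt ℂ Φ (starRingEnd ℂ z) := by
          refine hΦd _ (hball _ (Complex.mem_reProdIm.2 ⟨?_, ?_⟩)) ?_
          · rw [Complex.conj_re]; exact Ioo_subset_Icc_self h1
          · rw [Complex.conj_im]; constructor <;> linarith [h2.1, h2.2]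
          · simpa using h2.1
        simpa [Function.comp_def] using h3.conj_conj
      · intro x hx
        simp only [Complex.conj_ofReal]
        rw [hΦ x (hre x hx)]
        simp
        ring
  have hs₀ : s₀ ∈ Ioo (s₀ - d) (s₀ + d) := ⟨by linarith, by linarith⟩
  refine ((hA s₀ hs₀).1.im_ofReal'.sub hR.re_ofReal').congr ?_
  filter_upwards [hRlim, Ioo_mem_nhds hs₀.1 hs₀.2] with s h1 h2
  have h3 := tendsto_nhds_unique h1 (hP s (hre s (Ioo_subset_Icc_self h2)))
  rw [Pi.sub_apply, (hA s h2).2, ← h3]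
  ring

/-- A regular closed real analytic curve extends to a biholomorphic map near each parameter
value, and it is the image of the real axis there. -/
theorem exists_biholomorphic_extension {p : ℝ → ℂ} {s₀ L : ℝ} (hL : 0 < L)
    (hp : Continuous p) (hps : AnalyticAt ℝ p s₀) (hp' : deriv p s₀ ≠ 0)
    (hper : Function.Periodic p (2 * L))
    (hinj : ∀ σ ∈ Icc (s₀ - L) (s₀ + L), p σ = p s₀ → σ = s₀) {V : Set ℂ} (hV : V ∈ 𝓝 (p s₀)) :
    ∃ (Γ : ℂ → ℂ) (r m M : ℝ), 0 < r ∧ r ≤ L ∧ 0 < m ∧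
      DifferentiableOn ℂ Γ (Metric.ball (s₀ : ℂ) r) ∧
      (∀ z ∈ Metric.ball (s₀ : ℂ) r, ∀ w ∈ Metric.ball (s₀ : ℂ) r,
        m * ‖z - w‖ ≤ ‖Γ z - Γ w‖ ∧ ‖Γ z - Γ w‖ ≤ M * ‖z - w‖) ∧
      (∀ z ∈ Metric.ball (s₀ : ℂ) r, deriv Γ z ≠ 0) ∧
      (∀ s : ℝ, (s : ℂ) ∈ Metric.ball (s₀ : ℂ) r → Γ s = p s ∧ deriv Γ s = deriv p s) ∧
      ∀ z ∈ Metric.ball (s₀ : ℂ) r, Γ z ∈ V ∧ (Γ z ∈ range p → z.im = 0) := by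
  obtain ⟨Γ, hΓ, hΓp⟩ := hps.exists_complex_extension
  have hmem : ∀ {s r : ℝ}, (s : ℂ) ∈ Metric.ball (s₀ : ℂ) r ↔ s ∈ Metric.ball s₀ r := by
    intro s r
    rw [Metric.mem_ball, Metric.mem_ball, Complex.dist_eq, ← Complex.ofReal_sub, Complex.norm_real,
      Real.norm_eq_abs, Real.dist_eq]
  have hderiv : deriv p s₀ = deriv Γ s₀ :=
    (hΓ.differentiableAt.hasDerivAt.comp_ofReal.congr_of_eventuallyEq
      (hΓp.mono fun x hx => hx.symm)).deriv
  have hΓ0 : deriv Γ s₀ ≠ 0 := hderiv ▸ hp'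
  set m := ‖deriv Γ s₀‖ / 2 with hm
  have hm0 : 0 < m := by have := norm_pos_iff.2 hΓ0; positivity
  have hstrict := (HasStrictFDerivAt.isLittleO hΓ.hasStrictDerivAt).bound hm0
  rw [nhds_prod_eq] at hstrict
  obtain ⟨t, ht, htb⟩ := (eventually_prod_self_iff (r := fun z w => ‖Γ z - Γ w -
    ContinuousLinearMap.toSpanSingleton ℂ (deriv Γ (s₀ : ℂ)) (z - w)‖ ≤ m * ‖z - w‖)).1 hstrict
  have hev : ∀ᶠ z in 𝓝 (s₀ : ℂ), z ∈ t ∧ DifferentiableAt ℂ Γ z ∧ deriv Γ z ≠ 0 :=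
    (eventually_of_mem ht fun _ h => h).and ((hΓ.eventually_analyticAt.mono fun z hz =>
      hz.differentiableAt).and (hΓ.deriv.continuousAt.eventually_ne hΓ0))
  obtain ⟨r₁, hr₁, hb₁⟩ := Metric.eventually_nhds_iff_ball.1 hev
  obtain ⟨r₂, hr₂, hb₂⟩ := Metric.eventually_nhds_iff_ball.1 hΓp
  set r₃ := min r₁ (min r₂ L) with hr₃
  have hr₃0 : 0 < r₃ := lt_min hr₁ (lt_min hr₂ hL)
  have hr₃1 : r₃ ≤ r₁ := min_le_left _ _
  have hr₃2 : r₃ ≤ r₂ := (min_le_right _ _).trans (min_le_left _ _)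
  have hr₃L : r₃ ≤ L := (min_le_right _ _).trans (min_le_right _ _)
  have hp3 : ∀ s : ℝ, s ∈ Metric.ball s₀ r₃ → Γ s = p s := fun s hs =>
    hb₂ s (Metric.ball_subset_ball hr₃2 hs)
  have hlip : ∀ z ∈ Metric.ball (s₀ : ℂ) r₃, ∀ w ∈ Metric.ball (s₀ : ℂ) r₃,
      m * ‖z - w‖ ≤ ‖Γ z - Γ w‖ ∧ ‖Γ z - Γ w‖ ≤ (3 * m) * ‖z - w‖ := by
    intro z hz w hw
    have h1 := htb z (hb₁ z (Metric.ball_subset_ball hr₃1 hz)).1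
      w (hb₁ w (Metric.ball_subset_ball hr₃1 hw)).1
    have h2 : (ContinuousLinearMap.toSpanSingleton ℂ (deriv Γ (s₀ : ℂ))) (z - w) =
        (z - w) * deriv Γ s₀ := by
      simp
    rw [h2] at h1
    have h3 : ‖(z - w) * deriv Γ s₀‖ = 2 * m * ‖z - w‖ := by
      rw [norm_mul, hm]; ring
    have h4 := norm_sub_norm_le ((z - w) * deriv Γ s₀) (Γ z - Γ w)
    have h5 := norm_sub_norm_le (Γ z - Γ w) ((z - w) * deriv Γ s₀)
    rw [norm_sub_rev ((z - w) * deriv Γ s₀)] at h4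
    constructor <;> linarith
  -- the remaining part of the curve stays away from `p s₀`
  have hfar : ∀ᶠ z in 𝓝 (s₀ : ℂ),
      Γ z ∈ V ∧ Γ z ∉ p '' (Icc (s₀ - L) (s₀ + L) \ Metric.ball s₀ r₃) := by
    have hΓs : Γ s₀ = p s₀ := hp3 s₀ (Metric.mem_ball_self hr₃0)
    have hc : IsCompact (p '' (Icc (s₀ - L) (s₀ + L) \ Metric.ball s₀ r₃)) :=
      (isCompact_Icc.diff Metric.isOpen_ball).image hp
    refine (hΓ.continuousAt.eventually_mem (by rwa [hΓs])).and
      (hΓ.continuousAt.eventually_mem (hc.isClosed.isOpen_compl.mem_nhds ?_))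
    rw [hΓs]
    rintro ⟨σ, hσ, h⟩
    exact hσ.2 (by rw [hinj σ hσ.1 h]; exact Metric.mem_ball_self hr₃0)
  obtain ⟨r₄, hr₄, hb₄⟩ := Metric.eventually_nhds_iff_ball.1 hfar
  have hr3 : Metric.ball (s₀ : ℂ) (min r₃ r₄) ⊆ Metric.ball (s₀ : ℂ) r₃ :=
    Metric.ball_subset_ball (min_le_left _ _)
  have hr1 : Metric.ball (s₀ : ℂ) (min r₃ r₄) ⊆ Metric.ball (s₀ : ℂ) r₁ :=
    hr3.trans (Metric.ball_subset_ball hr₃1)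
  have hr4 : Metric.ball (s₀ : ℂ) (min r₃ r₄) ⊆ Metric.ball (s₀ : ℂ) r₄ :=
    Metric.ball_subset_ball (min_le_right _ _)
  refine ⟨Γ, min r₃ r₄, m, 3 * m, lt_min hr₃0 hr₄, (min_le_left _ _).trans hr₃L, hm0,
    fun z hz => (hb₁ z (hr1 hz)).2.1.differentiableWithinAt,
    fun z hz w hw => hlip z (hr3 hz) w (hr3 hw), fun z hz => (hb₁ z (hr1 hz)).2.2,
    fun s hs => ⟨hp3 s (hmem.1 (hr3 hs)), ?_⟩, fun z hz => ⟨(hb₄ z (hr4 hz)).1, ?_⟩⟩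
  · refine ((hb₁ s (hr1 hs)).2.1.hasDerivAt.comp_ofReal.congr_of_eventuallyEq ?_).deriv.symm
    filter_upwards [Metric.isOpen_ball.mem_nhds (hmem.1 (hr3 hs))] with x hx
    exact (hp3 x hx).symm
  · rintro ⟨σ, hσ⟩
    obtain ⟨τ, hτ, hτσ⟩ := hper.exists_mem_Ico (by positivity) σ (s₀ - L)
    have hτI : τ ∈ Icc (s₀ - L) (s₀ + L) := ⟨hτ.1, by linarith [hτ.2]⟩
    by_cases hτb : τ ∈ Metric.ball s₀ r₃
    · have h1 := (hlip z (hr3 hz) τ (hmem.2 hτb)).1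
      rw [hp3 τ hτb, ← hσ, hτσ, sub_self, norm_zero] at h1
      have h2 : ‖z - τ‖ ≤ 0 := by nlinarith [norm_nonneg (z - τ)]
      rw [sub_eq_zero.1 (norm_le_zero_iff.1 h2), Complex.ofReal_im]
    · exact absurd ⟨τ, ⟨hτI, hτb⟩, by rw [← hτσ, hσ]⟩ (hb₄ z (hr4 hz)).2

/-- A periodic function which is injective on a fundamental domain is injective up to periods. -/
theorem Function.Periodic.eq_of_abs_sub_lt {α : Type*} {p : ℝ → α} {T : ℝ} (hT : 0 < T)
    (hper : Function.Periodic p T) (hinj : InjOn p (Ico 0 T)) {σ s : ℝ} (h : p σ = p s)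
    (hσ : |σ - s| < T) : σ = s := by
  obtain ⟨n, hn⟩ := (toIcoMod_eq_toIcoMod hT (a := 0) (b := s) (c := σ)).1 (hinj
    (toIcoMod_mem_Ico' hT s) (toIcoMod_mem_Ico' hT σ) (by
      rw [toIcoMod, toIcoMod, hper.sub_zsmul_eq, hper.sub_zsmul_eq, h]))
  rw [hn, zsmul_eq_mul, abs_mul, abs_of_pos hT] at hσ
  have h1 : |(n : ℝ)| < 1 := by
    by_contra! h1
    nlinarith
  have h2 : n = 0 := Int.abs_lt_one_iff.1 (by exact_mod_cast h1)
  rw [h2, zero_smul] at hn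
  linarith

/-- A transversal to a curve at a parameter value enters the corresponding side of the curve. -/
theorem exists_mem_side_of_transversal {Γ : ℂ → ℂ} {s κ ε : ℝ} {ν : ℂ} {D : Set ℂ}
    (hΓ : AnalyticAt ℂ Γ s) (hΓ' : deriv Γ s ≠ 0) (hD : D ∈ 𝓝 (s : ℂ))
    (hν : 0 < κ * (ν / deriv Γ s).im) (hε : 0 < ε) :
    ∃ z ∈ D, 0 < κ * z.im ∧ ∃ δ ∈ Ioo 0 ε, Γ z = Γ s + δ * ν := by
  have hs := hΓ.hasStrictDerivAt
  set φ := hs.localInverse Γ (deriv Γ s) s hΓ' with hφ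
  have hφs : φ (Γ s) = s := (hs.eventually_left_inverse hΓ').self_of_nhds
  set q : ℝ → ℂ := fun δ => φ (Γ s + δ * ν) with hq
  have hq0 : q 0 = s := by simp [hq, hφs]
  have hlin : HasDerivAt (fun δ : ℂ => Γ s + δ * ν) ν 0 := by
    simpa using ((hasDerivAt_id (0 : ℂ)).mul_const ν).const_add (Γ s)
  have hlin' : Tendsto (fun δ : ℝ => Γ s + (δ : ℂ) * ν) (𝓝 0) (𝓝 (Γ s)) := by
    have : ContinuousAt (fun δ : ℝ => Γ s + (δ : ℂ) * ν) 0 := by fun_prop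
    simpa [ContinuousAt] using this
  have hqd : HasDerivAt q (ν / deriv Γ s) 0 := by
    have h1 : HasDerivAt φ (deriv Γ s)⁻¹ (Γ s + ((0 : ℝ) : ℂ) * ν) := by
      simpa using (hs.to_localInverse hΓ').hasDerivAt
    have h2 := (HasDerivAt.comp (h := fun δ : ℂ => Γ s + δ * ν) ((0 : ℝ) : ℂ) h1
      (by simpa using hlin)).comp_ofReal
    rw [div_eq_inv_mul]
    exact h2
  have hIm : HasDerivAt (fun δ => κ * (q δ).im) (κ * (ν / deriv Γ s).im) 0 :=
    (Complex.imCLM.hasFDerivAt.comp_hasDerivAt (0 : ℝ) hqd).const_mul κ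
  have hpos : ∀ᶠ δ in 𝓝[>] (0 : ℝ), 0 < κ * (q δ).im := by
    have h1 := (hasDerivAt_iff_tendsto_slope.1 hIm).eventually_const_lt hν
    filter_upwards [h1.filter_mono (nhdsWithin_mono _ fun x (hx : 0 < x) => hx.ne'),
      self_mem_nhdsWithin] with δ h2 (h3 : 0 < δ)
    rw [slope_def_field, hq0, Complex.ofReal_im, mul_zero, sub_zero, sub_zero] at h2
    exact (div_pos_iff_of_pos_right h3).1 h2
  have hmem : ∀ᶠ δ in 𝓝[>] (0 : ℝ), q δ ∈ D := by
    refine nhdsWithin_le_nhds (hqd.continuousAt.eventually_mem ?_)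
    rwa [hq0]
  have hinv : ∀ᶠ δ in 𝓝[>] (0 : ℝ), Γ (q δ) = Γ s + δ * ν :=
    nhdsWithin_le_nhds (hlin'.eventually (hs.eventually_right_inverse hΓ'))
  obtain ⟨δ, h1, h2, h3, h4⟩ := (hpos.and (hmem.and (hinv.and
    (Ioo_mem_nhdsGT hε)))).exists
  exact ⟨q δ, h2, h1, δ, h4, h3⟩

/-- Locally, exactly one side of the boundary curve of an open set is exterior, provided that the
exterior can be reached along a transversal field `ν`. -/
theorem exists_exterior_side {Γ : ℂ → ℂ} {s₀ r : ℝ} {O : Set ℂ} {ν : ℝ → ℂ} (hr : 0 < r)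
    (hΓ : DifferentiableOn ℂ Γ (Metric.ball (s₀ : ℂ) r))
    (hΓ' : ∀ z ∈ Metric.ball (s₀ : ℂ) r, deriv Γ z ≠ 0) (hO : IsOpen O)
    (hfr : ∀ s : ℝ, (s : ℂ) ∈ Metric.ball (s₀ : ℂ) r → Γ s ∈ frontier O)
    (hfr' : ∀ z ∈ Metric.ball (s₀ : ℂ) r, Γ z ∈ frontier O → z.im = 0)
    (hν : ∀ s : ℝ, (s : ℂ) ∈ Metric.ball (s₀ : ℂ) r → (ν s / deriv Γ s).im ≠ 0)
    (hout : ∀ s : ℝ, (s : ℂ) ∈ Metric.ball (s₀ : ℂ) r →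
      ∃ ε > 0, ∀ δ ∈ Ioo (0 : ℝ) ε, Γ s + δ * ν s ∉ closure O) :
    ∃ κ : ℝ, (κ = 1 ∨ κ = -1) ∧
      (∀ z ∈ Metric.ball (s₀ : ℂ) r, 0 < κ * z.im → Γ z ∉ closure O) ∧
      ∀ s : ℝ, (s : ℂ) ∈ Metric.ball (s₀ : ℂ) r → 0 < κ * (ν s / deriv Γ s).im := by
  have hside : ∀ κ s : ℝ, (s : ℂ) ∈ Metric.ball (s₀ : ℂ) r → 0 < κ * (ν s / deriv Γ s).im →
      ∀ z ∈ Metric.ball (s₀ : ℂ) r, 0 < κ * z.im → Γ z ∉ closure O := by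
    intro κ s hs hκ z hz hzκ
    set S := Metric.ball (s₀ : ℂ) r ∩ {z | 0 < κ * z.im} with hS
    have hconv : Convex ℝ S := by
      refine (convex_ball _ _).inter ?_
      have : IsLinearMap ℝ fun z : ℂ => κ * z.im :=
        ⟨fun a b => by rw [Complex.add_im]; ring, fun a b => by simp; ring⟩
      exact convex_halfSpace_gt this 0
    have hpre : IsPreconnected (Γ '' S) :=
      hconv.isPreconnected.image _ (hΓ.continuousOn.mono inter_subset_left)
    have hsub : Γ '' S ⊆ (closure O)ᶜ ∪ O := by
      rintro _ ⟨w, hw, rfl⟩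
      by_contra hcon
      rw [mem_union, not_or, mem_compl_iff, not_not] at hcon
      have h1 : Γ w ∈ frontier O := by
        rw [hO.frontier_eq]; exact hcon
      have h2 := hw.2
      simp [hfr' w hw.1 h1] at h2
    obtain ⟨ε, hε, hεout⟩ := hout s hs
    obtain ⟨w, hw, hwκ, δ, hδ, hwδ⟩ := exists_mem_side_of_transversal
      (hΓ.analyticAt (Metric.isOpen_ball.mem_nhds hs)) (hΓ' s hs)
      (Metric.isOpen_ball.mem_nhds hs) hκ hε
    have hne : (Γ '' S ∩ (closure O)ᶜ).Nonempty :=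
      ⟨Γ w, ⟨w, ⟨hw, hwκ⟩, rfl⟩, by rw [hwδ]; exact hεout δ hδ⟩
    exact hpre.subset_left_of_subset_union isClosed_closure.isOpen_compl hO
      (disjoint_compl_left_iff_subset.2 subset_closure) hsub hne ⟨z, ⟨hz, hzκ⟩, rfl⟩
  have hs₀ : (s₀ : ℂ) ∈ Metric.ball (s₀ : ℂ) r := Metric.mem_ball_self hr
  -- both sides cannot be exterior
  have hboth : ¬ ((∀ z ∈ Metric.ball (s₀ : ℂ) r, 0 < 1 * z.im → Γ z ∉ closure O) ∧
      ∀ z ∈ Metric.ball (s₀ : ℂ) r, 0 < -1 * z.im → Γ z ∉ closure O) := by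
    rintro ⟨h1, h2⟩
    have hnhds : Γ '' Metric.ball (s₀ : ℂ) r ∈ 𝓝 (Γ s₀) := by
      rw [← ((hΓ.analyticAt (Metric.ball_mem_nhds _ hr)).hasStrictDerivAt).map_nhds_eq (hΓ' _ hs₀)]
      exact image_mem_map (Metric.ball_mem_nhds _ hr)
    obtain ⟨_, ⟨z, hz, rfl⟩, hzO⟩ := mem_closure_iff_nhds.1
      (frontier_subset_closure (hfr s₀ hs₀)) _ hnhds
    rcases lt_trichotomy z.im 0 with h | h | h
    · exact h2 z hz (by linarith) (subset_closure hzO)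
    · have hzr : z = z.re := Complex.ext (by simp) (by simp [h])
      have h3 := hfr z.re (by rwa [← hzr])
      rw [← hzr, hO.frontier_eq] at h3
      exact h3.2 hzO
    · exact h1 z hz (by linarith) (subset_closure hzO)
  by_cases h : ∀ z ∈ Metric.ball (s₀ : ℂ) r, 0 < 1 * z.im → Γ z ∉ closure O
  · refine ⟨1, Or.inl rfl, h, fun s hs => ?_⟩
    by_contra hcon
    refine hboth ⟨h, hside (-1) s hs ?_⟩
    have := lt_of_le_of_ne (not_lt.1 hcon) (by rw [one_mul]; exact hν s hs)
    linarith
  · have hneg : ∀ s : ℝ, (s : ℂ) ∈ Metric.ball (s₀ : ℂ) r → 0 < -1 * (ν s / deriv Γ s).im := by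
      intro s hs
      by_contra hcon
      refine h (hside 1 s hs ?_)
      have := lt_of_le_of_ne (not_lt.1 hcon) (by rw [neg_one_mul]; exact neg_ne_zero.2 (hν s hs))
      linarith
    exact ⟨-1, Or.inr rfl, hside (-1) s₀ hs₀ (hneg s₀ hs₀), hneg⟩

/-- If the Cauchy problem for the Cauchy-Riemann equations in the exterior of an analytic closed
curve with tangential data `f` and normal data `h` has a solution, then `f` differs from the
principal value transform `H` of `h` by a real analytic function. -/
theorem analyticAt_sub_of_cauchy_problem {O V : Set ℂ} (hO : IsOpen O) {p : ℝ → ℂ}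
    (hp : AnalyticOnNhd ℝ p univ) (hper : Function.Periodic p (2 * Real.pi))
    (hp' : ∀ s, deriv p s ≠ 0) (hrange : range p = frontier O)
    (hinj : InjOn p (Ico 0 (2 * Real.pi))) {ν : ℝ → ℂ} (hν : ∀ s, ‖ν s‖ = 1)
    (hνp : ∀ s, (ν s / deriv p s).re = 0)
    (hout : ∀ s, ∃ ε > 0, ∀ δ ∈ Ioo (0 : ℝ) ε, p s + δ * ν s ∉ closure O)
    {f h H : ℝ → ℝ} (hf : ContDiff ℝ 1 f) (hh : ContDiff ℝ 1 h)
    (hhper : Function.Periodic h (2 * Real.pi))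
    (hH : ∀ s : ℝ, Tendsto (fun ε : ℝ => ∫ σ in (0 : ℝ)..(2 * Real.pi),
      if ε ≤ ‖p s - p σ‖ then
        h σ * ((deriv p s / (p s - p σ)).re / ‖deriv p s‖) * ‖deriv p σ‖ else 0)
      (𝓝[>] 0) (𝓝 (Real.pi * H s)))
    (hV : IsOpen V) (hOV : frontier O ⊆ V) {F : ℂ → ℂ} (hFc : ContinuousOn F (V \ O))
    (hFd : DifferentiableOn ℂ F (V \ closure O))
    (hFf : ∀ s, (F (p s) * deriv p s).re = f s * ‖deriv p s‖)
    (hFh : ∀ s, (F (p s) * ν s).re = h s) (s₀ : ℝ) :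
    AnalyticAt ℝ (fun s => f s - H s) s₀ := by
  have hpi := Real.pi_pos
  have hpc : Continuous p := continuousOn_univ.1 hp.continuousOn
  have hps₀ : p s₀ ∈ frontier O := hrange ▸ mem_range_self s₀
  have hinj' : ∀ σ ∈ Icc (s₀ - Real.pi) (s₀ + Real.pi), p σ = p s₀ → σ = s₀ := fun σ hσ h =>
    hper.eq_of_abs_sub_lt (by positivity) hinj h (by
      rw [abs_lt]; constructor <;> linarith [hσ.1, hσ.2])
  obtain ⟨Γ, r, m, M, hr, hrL, hm, hΓ, hlip, hΓ', hΓp, hΓV⟩ :=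
    exists_biholomorphic_extension hpi hpc (hp s₀ (mem_univ _)) (hp' s₀) hper hinj'
      (hV.mem_nhds (hOV hps₀))
  have hfr : ∀ s : ℝ, (s : ℂ) ∈ Metric.ball (s₀ : ℂ) r → Γ s ∈ frontier O := fun s hs => by
    rw [(hΓp s hs).1, ← hrange]; exact mem_range_self s
  have hnd : ∀ s, ‖deriv p s‖ ≠ 0 := fun s => norm_ne_zero_iff.2 (hp' s)
  have hν0 : ∀ s, (ν s / deriv p s).im ≠ 0 := fun s h0 => by
    have h1 : ν s / deriv p s = 0 := Complex.ext (hνp s) h0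
    have h2 := hν s
    rcases div_eq_zero_iff.1 h1 with h3 | h3
    · rw [h3, norm_zero] at h2; norm_num at h2
    · exact hp' s h3
  obtain ⟨κ, hκ, hκout, hκν⟩ := exists_exterior_side (ν := ν) hr hΓ hΓ' hO hfr
    (fun z hz hzO => (hΓV z hz).2 (hrange ▸ hzO))
    (fun s hs => by rw [(hΓp s hs).2]; exact hν0 s)
    (fun s hs => by rw [(hΓp s hs).1]; exact hout s)
  have hκ2 : κ * κ = 1 := by rcases hκ with rfl | rfl <;> norm_num
  have hF : ∀ s : ℝ, (s : ℂ) ∈ Metric.ball (s₀ : ℂ) r →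
      (F (p s) * deriv p s).im = -(κ * (h s * ‖deriv p s‖)) := by
    intro s hs
    have h1 := hκν s hs
    rw [(hΓp s hs).2] at h1
    have h2 : κ * (ν s / deriv p s).im = ‖deriv p s‖⁻¹ := by
      have h3 : ‖ν s / deriv p s‖ = |(ν s / deriv p s).im| := by
        have h4 := Complex.re_add_im (ν s / deriv p s)
        rw [hνp s, Complex.ofReal_zero, zero_add] at h4
        rw [← h4, norm_mul, Complex.norm_I, mul_one, Complex.norm_real, Real.norm_eq_abs, h4]
      rw [norm_div, hν s, one_div] at h3
      rw [h3, ← abs_of_pos h1, abs_mul]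
      rcases hκ with rfl | rfl <;> simp
    have h5 : F (p s) * ν s = (F (p s) * deriv p s) * (ν s / deriv p s) := by
      have := hp' s
      field_simp
    have h6 := hFh s
    rw [h5, Complex.mul_re, hνp s, mul_zero, zero_sub] at h6
    have h7 : (ν s / deriv p s).im = κ * ‖deriv p s‖⁻¹ := by
      rw [← h2, ← mul_assoc, hκ2, one_mul]
    rw [← h6, h7]
    have h8 := hnd s
    field_simp
    rw [sq, hκ2]
    ring
  have hdC : ContDiff ℝ 1 (fun s => ‖deriv p s‖) := hp.deriv.contDiff.norm ℝ hp'
  have hderiv_per : Function.Periodic (deriv p) (2 * Real.pi) := fun s => by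
    rw [← deriv_comp_add_const]
    congr 1
    exact funext hper
  have key := analyticAt_sub_principal_value (u := fun s => f s * ‖deriv p s‖)
    (g := fun s => h s * ‖deriv p s‖) (P := fun s => ‖deriv p s‖ * (Real.pi * H s))
    (Φ := fun z => F (Γ z) * deriv Γ z) hpc hr hΓ hm (fun z hz w hw => (hlip z hz w hw).1)
    (fun z hz w hw => (hlip z hz w hw).2) hΓ' (fun s hs => (hΓp s hs).1)
    ((hf.mul hdC).differentiable (by norm_num)) (hh.mul hdC) hrL hinj' ?_ hκ ?_ ?_ ?_
  · have hda : AnalyticAt ℝ (fun s => ‖deriv p s‖) s₀ :=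
      ((hp.deriv s₀ (mem_univ _)).contDiffAt.norm ℝ (hp' s₀)).analyticAt
    refine (key.div (analyticAt_const.mul hda) (mul_ne_zero hpi.ne' (hnd s₀))).congr
      (Eventually.of_forall fun s => ?_)
    have := hnd s
    simp only [Pi.div_apply, Pi.mul_apply]
    field_simp
  · intro s hs
    refine ((hH s).const_mul ‖deriv p s‖).congr fun ε => ?_
    have hpp : Function.Periodic (fun σ => if ε ≤ ‖p s - p σ‖ then
        h σ * ((deriv p s / (p s - p σ)).re / ‖deriv p s‖) * ‖deriv p σ‖ else 0)
        (2 * Real.pi) := fun σ => by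
      simp only [hper σ, hderiv_per σ, hhper σ]
    have hsh := hpp.intervalIntegral_add_eq 0 (s₀ - Real.pi)
    rw [zero_add] at hsh
    rw [hsh, ← intervalIntegral.integral_const_mul,
      show s₀ - Real.pi + 2 * Real.pi = s₀ + Real.pi by ring]
    refine intervalIntegral.integral_congr fun σ _ => ?_
    simp only [(hΓp s hs).2, Complex.re_ofReal_mul]
    have := hnd s
    split_ifs
    · field_simp
    · simp
  · refine ContinuousOn.mul (hFc.comp (hΓ.continuousOn.mono inter_subset_left) ?_)
      ((hΓ.deriv Metric.isOpen_ball).continuousOn.mono inter_subset_left)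
    intro z hz
    refine ⟨(hΓV z hz.1).1, ?_⟩
    rcases (show 0 ≤ κ * z.im from hz.2).eq_or_lt with h0 | h0
    · have hκ0 : κ ≠ 0 := fun h => by simp [h] at hκ2
      have him : z.im = 0 := (mul_eq_zero.1 h0.symm).resolve_left hκ0
      have hzr : z = z.re := Complex.ext (by simp) (by simp [him])
      have h3 := hfr z.re (by rw [← hzr]; exact hz.1)
      rw [← hzr, hO.frontier_eq] at h3
      exact h3.2
    · exact fun hzO => hκout z hz.1 h0 (subset_closure hzO)
  · intro z hz hzκ
    have h1 : V \ closure O ∈ 𝓝 (Γ z) :=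
      (hV.sdiff isClosed_closure).mem_nhds ⟨(hΓV z hz).1, hκout z hz hzκ⟩
    have h2 := hΓ.differentiableAt (Metric.isOpen_ball.mem_nhds hz)
    exact ((hFd.differentiableAt h1).comp z h2).mul
      ((hΓ.deriv Metric.isOpen_ball).differentiableAt (Metric.isOpen_ball.mem_nhds hz))
  · intro s hs
    simp only [(hΓp s hs).1, (hΓp s hs).2]
    refine Complex.ext ?_ ?_
    · rw [hFf s]; simp
    · rw [hF s hs]; simp

theorem hasDerivAt_prodMk_fst {x y : ℝ} :
    HasDerivAt (fun t : ℝ => (t, y)) ((1, 0) : ℝ × ℝ) x :=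
  (hasDerivAt_id x).prodMk (hasDerivAt_const x y)

theorem hasDerivAt_prodMk_snd {x y : ℝ} :
    HasDerivAt (fun t : ℝ => (x, t)) ((0, 1) : ℝ × ℝ) y :=
  (hasDerivAt_const y x).prodMk (hasDerivAt_id y)

theorem pdx_eq {F : ℝ × ℝ → ℝ} {F' : ℝ × ℝ →L[ℝ] ℝ} {q : ℝ × ℝ} (hF : HasFDerivAt F F' q) :
    pdx F q = F' (1, 0) :=
  (HasFDerivAt.comp_hasDerivAt (l := F) q.1 hF hasDerivAt_prodMk_fst).deriv

theorem pdy_eq {F : ℝ × ℝ → ℝ} {F' : ℝ × ℝ →L[ℝ] ℝ} {q : ℝ × ℝ} (hF : HasFDerivAt F F' q) :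
    pdy F q = F' (0, 1) :=
  (HasFDerivAt.comp_hasDerivAt (l := F) q.2 hF hasDerivAt_prodMk_snd).deriv

/-- A planar vector field `B` with vanishing divergence and curl is the conjugate of the
holomorphic function `B₁ - i B₂`. -/
theorem differentiableAt_conj_vector_field {B : ℝ × ℝ → ℝ × ℝ} {z : ℂ}
    (hB : DifferentiableAt ℝ B (Complex.equivRealProdCLM z))
    (hdiv : divg B (Complex.equivRealProdCLM z) = 0)
    (hcurl : curl2 B (Complex.equivRealProdCLM z) = 0) :
    DifferentiableAt ℂ (fun w : ℂ => ((B (Complex.equivRealProdCLM w)).1 : ℂ) -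
      (B (Complex.equivRealProdCLM w)).2 * Complex.I) z := by
  set e := Complex.equivRealProdCLM
  set B' := fderiv ℝ B (e z)
  have h1 : HasFDerivAt (fun q => (B q).1) ((ContinuousLinearMap.fst ℝ ℝ ℝ).comp B') (e z) :=
    hB.hasFDerivAt.fst
  have h2 : HasFDerivAt (fun q => (B q).2) ((ContinuousLinearMap.snd ℝ ℝ ℝ).comp B') (e z) :=
    hB.hasFDerivAt.snd
  rw [divg, pdx_eq h1, pdy_eq h2] at hdiv
  rw [curl2, pdx_eq h2, pdy_eq h1] at hcurl
  simp only [ContinuousLinearMap.comp_apply, ContinuousLinearMap.coe_fst',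
    ContinuousLinearMap.coe_snd'] at hdiv hcurl
  have hBe : HasFDerivAt (fun w => B (e w)) (B'.comp (e : ℂ →L[ℝ] ℝ × ℝ)) z :=
    HasFDerivAt.comp z hB.hasFDerivAt e.hasFDerivAt
  have hF := (Complex.ofRealCLM.hasFDerivAt.comp z hBe.fst).sub
    ((Complex.ofRealCLM.hasFDerivAt.comp z hBe.snd).mul_const Complex.I)
  refine differentiableAt_complex_iff_differentiableAt_real.2 ⟨hF.differentiableAt, ?_⟩
  have key := hF.fderiv
  have e1 : e 1 = (1, 0) := by simp [e]
  have eI : e Complex.I = (0, 1) := by simp [e]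
  have : fderiv ℝ (fun w : ℂ => ((B (e w)).1 : ℂ) - (B (e w)).2 * Complex.I) z = _ := key
  rw [this]
  simp [e1, eI]
  apply Complex.ext <;> simp <;> linarith

theorem dot_eq_re (u v : ℝ × ℝ) :
    dot u v = (((u.1 : ℂ) - u.2 * Complex.I) * Complex.equivRealProdCLM.symm v).re := by
  simp [dot]

theorem enorm2_eq_norm (v : ℝ × ℝ) : enorm2 v = ‖Complex.equivRealProdCLM.symm v‖ := by
  rw [Complex.norm_eq_sqrt_sq_add_sq]
  simp [enorm2]

theorem dot_div_enorm2_sq (u v : ℝ × ℝ) :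
    dot u v / enorm2 v ^ 2 =
      (Complex.equivRealProdCLM.symm u / Complex.equivRealProdCLM.symm v).re := by
  rw [enorm2_eq_norm, ← Complex.normSq_eq_norm_sq, Complex.div_re, ← add_div]
  simp [dot]

theorem dot_smul_left (c : ℝ) (u v : ℝ × ℝ) : dot (c • u) v = c * dot u v := by
  simp [dot]; ring

theorem dot_smul_right (c : ℝ) (u v : ℝ × ℝ) : dot u (c • v) = c * dot u v := by
  simp [dot]; ring

theorem enorm2_ne_zero {v : ℝ × ℝ} (hv : v ≠ 0) : enorm2 v ≠ 0 := by
  rw [enorm2_eq_norm]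
  simpa using hv

/-- necessity of the compatibility-regularity condition.
Let `Ω ⊂ ℝ²` be open, bounded and simply connected with real analytic boundary `∂Ω`
(regularly parameterised by the `2π`-periodic real analytic `γ`), with unit tangent field `tau`
and outward unit normal field `nor`, and let `f, h ∈ C¹(∂Ω)`. Let `Hh` be given by the principal
value `(Hh)(v) = (1/π) lim_{ε→0} ∫_{∂Ω∖B_ε(v)} h(w) (t(v)·(v−w))/|v−w|² dw` (arclength integral).
If the Cauchy problem `div B = 0`, `curl B = 0` on `U ∖ cl Ω`, `B·t = f`, `B·n = h` on `∂Ω` has a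
solution `B ∈ C¹(U∖cl Ω) ∩ C(U∖Ω)` for some open connected `U ⊇ cl Ω`, then `f − Hh` is real
analytic on `∂Ω`. -/
theorem stmt3
    (Ω : Set (ℝ × ℝ)) (hΩo : IsOpen Ω) (hΩb : Bornology.IsBounded Ω)
    (hΩsc : SimplyConnectedSpace Ω)
    (γ : ℝ → ℝ × ℝ)
    (hγan : AnalyticOnNhd ℝ γ Set.univ)
    (hγper : Function.Periodic γ (2 * Real.pi))
    (hγreg : ∀ s : ℝ, deriv γ s ≠ 0)
    (hγrange : Set.range γ = frontier Ω)
    (hγinj : Set.InjOn γ (Set.Ico 0 (2 * Real.pi)))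
    (tau nor : ℝ × ℝ → ℝ × ℝ)
    -- tau is the unit tangent to ∂Ω
    (htau : ∀ s : ℝ, tau (γ s) = (enorm2 (deriv γ s))⁻¹ • deriv γ s)
    -- nor is the outward unit normal to ∂Ω
    (hnor1 : ∀ v ∈ frontier Ω, enorm2 (nor v) = 1)
    (hnor2 : ∀ v ∈ frontier Ω, dot (nor v) (tau v) = 0)
    (hnor3 : ∀ v ∈ frontier Ω, ∃ ε > (0 : ℝ), ∀ δ ∈ Set.Ioo (0 : ℝ) ε,
      v + δ • nor v ∉ closure Ω)
    (f h : ℝ × ℝ → ℝ)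
    -- f, h ∈ C¹(∂Ω)
    (hf : ContDiff ℝ 1 (fun s : ℝ => f (γ s)))
    (hh : ContDiff ℝ 1 (fun s : ℝ => h (γ s)))
    -- Hh is the principal-value integral operator applied to h
    (Hh : ℝ × ℝ → ℝ)
    (hHh : ∀ s : ℝ, Filter.Tendsto (fun ε : ℝ =>
        ∫ σ in (0 : ℝ)..(2 * Real.pi),
          (if ε ≤ enorm2 (γ s - γ σ) then
            h (γ σ) * (dot (tau (γ s)) (γ s - γ σ) / enorm2 (γ s - γ σ) ^ 2) *
              enorm2 (deriv γ σ)
          else 0))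
        (𝓝[>] 0) (𝓝 (Real.pi * Hh (γ s))))
    -- the Cauchy problem has a solution
    (hex : ∃ (U : Set (ℝ × ℝ)) (B : ℝ × ℝ → ℝ × ℝ),
      IsOpen U ∧ IsConnected U ∧ closure Ω ⊆ U ∧
      ContDiffOn ℝ 1 B (U \ closure Ω) ∧ ContinuousOn B (U \ Ω) ∧
      (∀ p ∈ U \ closure Ω, divg B p = 0) ∧
      (∀ p ∈ U \ closure Ω, curl2 B p = 0) ∧
      (∀ v ∈ frontier Ω, dot (B v) (tau v) = f v) ∧
      (∀ v ∈ frontier Ω, dot (B v) (nor v) = h v)) :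
    -- then f − Hh is real analytic on ∂Ω
    AnalyticOnNhd ℝ (fun s : ℝ => f (γ s) - Hh (γ s)) Set.univ := by
  intro s₀ _
  obtain ⟨U, B, hU, -, hΩU, hB1, hB0, hdiv, hcurl, hBf, hBh⟩ := hex
  have hγfr (s : ℝ) : γ s ∈ frontier Ω := hγrange ▸ mem_range_self s
  have hreg (s : ℝ) : enorm2 (deriv γ s) ≠ 0 := enorm2_ne_zero (hγreg s)
  set e := Complex.equivRealProdCLM
  have hpd (s : ℝ) : deriv (fun s => e.symm (γ s)) s = e.symm (deriv γ s) :=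
    (e.symm.toContinuousLinearMap.hasFDerivAt.comp_hasDerivAt s
      (hγan s (mem_univ s)).differentiableAt.hasDerivAt).deriv
  have hfr : frontier (e ⁻¹' Ω) = e ⁻¹' frontier Ω :=
    (e.toHomeomorph.preimage_frontier Ω).symm
  have hcl : closure (e ⁻¹' Ω) = e ⁻¹' closure Ω :=
    (e.toHomeomorph.preimage_closure Ω).symm
  refine analyticAt_sub_of_cauchy_problem (O := e ⁻¹' Ω) (V := e ⁻¹' U)
    (p := fun s => e.symm (γ s)) (ν := fun s => e.symm (nor (γ s)))
    (f := fun s => f (γ s)) (h := fun s => h (γ s)) (H := fun s => Hh (γ s))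
    (F := fun z => ((B (e z)).1 : ℂ) - (B (e z)).2 * Complex.I)
    (hΩo.preimage e.continuous) ?_ ?_ ?_ ?_ ?_ ?_ ?_ ?_ hf hh ?_ ?_
    (hU.preimage e.continuous) ?_ ?_ ?_ ?_ ?_ s₀
  · intro s _
    exact (e.symm.toContinuousLinearMap.analyticAt _).comp (hγan s (mem_univ s))
  · intro s
    simp only [hγper s]
  · intro s
    simpa [hpd] using hγreg s
  · rw [hfr, ← hγrange]
    ext z
    simp only [mem_range, mem_preimage]
    exact exists_congr fun s => by
      rw [ContinuousLinearEquiv.symm_apply_eq]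
  · intro s hs t ht hst
    exact hγinj hs ht (e.symm.injective hst)
  · intro s
    rw [← enorm2_eq_norm, hnor1 _ (hγfr s)]
  · intro s
    have h0 := hnor2 _ (hγfr s)
    rw [htau, dot_smul_right, mul_eq_zero] at h0
    simp only [hpd]
    rw [← dot_div_enorm2_sq, h0.resolve_left (inv_ne_zero (hreg s)), zero_div]
  · intro s
    obtain ⟨ε, hε, hout⟩ := hnor3 _ (hγfr s)
    refine ⟨ε, hε, fun δ hδ hmem => hout δ hδ ?_⟩
    rw [hcl, mem_preimage] at hmem
    convert hmem using 1
    apply e.symm.injective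
    simp
  · intro s
    simp only [hγper s]
  · intro s
    convert hHh s using 4 with ε σ
    rw [enorm2_eq_norm, map_sub]
    congr 1
    rw [← map_sub, ← enorm2_eq_norm, htau, dot_smul_left, mul_div_assoc, dot_div_enorm2_sq,
      enorm2_eq_norm, enorm2_eq_norm, hpd, hpd]
    ring
  · rw [hfr]
    exact preimage_mono (frontier_subset_closure.trans hΩU)
  · have hBe : ContinuousOn (fun z => B (e z)) (e ⁻¹' U \ e ⁻¹' Ω) :=
      hB0.comp e.continuous.continuousOn fun z hz => hz
    exact (Complex.continuous_ofReal.comp_continuousOn hBe.fst).sub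
      ((Complex.continuous_ofReal.comp_continuousOn hBe.snd).mul continuousOn_const)
  · intro z hz
    rw [hcl] at hz
    exact (differentiableAt_conj_vector_field ((hB1.contDiffAt
      ((hU.sdiff isClosed_closure).mem_nhds hz)).differentiableAt one_ne_zero)
      (hdiv _ hz) (hcurl _ hz)).differentiableWithinAt
  · intro s
    have h0 := hBf _ (hγfr s)
    rw [htau, dot_smul_right, inv_mul_eq_iff_eq_mul₀ (hreg s)] at h0
    simp only [hpd, e.apply_symm_apply]
    rw [← dot_eq_re, h0, enorm2_eq_norm, mul_comm]
  · intro s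
    simp only [e.apply_symm_apply]
    rw [← dot_eq_re, hBh _ (hγfr s)]
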